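/- Let s > d/2 and σ ≥ 2, assume the exact solution of the Zakharov system satisfies ‖ψ(t)‖_{s+2+σ} + |||(u(t),u̇(t))|||_{s+σ} ≤ M for 0 ≤ t−t₀ ≤ T with M ≥ 1, assume the a priori bound ‖φ_n^K‖_s + |||(u_n^K,u̇_n^K)|||_s ≤ 2C₀M on the fully discrete solution for τ ≤ t_n−t₀ ≤ T, and assume the CFL condition d τ K^2 ≤ c < 2π. Then there is a constant C, depending only on d, s, σ, M, T and c, such that the stability estimate |||(û_{n+1}^K, û̇_{n+1}^K) − (u_{n+1}^K, u̇_{n+1}^K)|||_s ≤ |||(u^K(t_n), u̇^K(t_n)) − (u_n^K, u̇_n^K)|||_s + C τ e_n^K holds for 0 ≤ t_n−t₀ ≤ T. -/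

import Mathlib

noncomputable section

namespace Zak

/-- Fourier coefficients of a function on the `d`-dimensional torus `𝕋^d`. -/
abbrev Coef (d : ℕ) := (Fin d → ℤ) → ℂ

/-- Euclidean norm `|j|` of a frequency `j ∈ ℤ^d`. -/
def absZ {d : ℕ} (j : Fin d → ℤ) : ℝ := Real.sqrt (∑ i, ((j i : ℝ)) ^ 2)

/-- Sobolev norm `‖v‖ₛ = (∑_j max(|j|,1)^{2s} |v_j|²)^{1/2}`. -/
def sobNorm {d : ℕ} (s : ℝ) (v : Coef d) : ℝ :=
  Real.sqrt (∑' j : Fin d → ℤ, (max (absZ j) 1) ^ (2 * s) * ‖v j‖ ^ 2)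

/-- Norm `|||(v, v̇)|||ₛ = (‖v‖_{s+1}² + ‖v̇‖ₛ²)^{1/2}` on `H^{s+1} × H^s`. -/
def pairNorm {d : ℕ} (s : ℝ) (v w : Coef d) : ℝ :=
  Real.sqrt (sobNorm (s + 1) v ^ 2 + sobNorm s w ^ 2)

/-- Convolution of Fourier coefficients (= product of the functions). -/
def conv {d : ℕ} (v w : Coef d) : Coef d := fun j => ∑' k : Fin d → ℤ, v k * w (j - k)

/-- Fourier coefficients of the complex conjugate function. -/
def conjC {d : ℕ} (v : Coef d) : Coef d := fun j => (starRingEnd ℂ) (v (-j))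

/-- Fourier coefficients of `|v|² = v ⬝ conj v`. -/
def absSq {d : ℕ} (v : Coef d) : Coef d := conv v (conjC v)

/-- Fourier coefficients of the real part of the function. -/
def reC {d : ℕ} (v : Coef d) : Coef d := fun j => (v j + (starRingEnd ℂ) (v (-j))) / 2

/-- Membership of a frequency in `𝒦 = {-K, …, K-1}^d`. -/
def inK (d K : ℕ) (j : Fin d → ℤ) : Prop := ∀ i, -(K : ℤ) ≤ j i ∧ j i < K

/-- Trigonometric polynomial of degree `K`: only modes in `𝒦` are present. -/
def isTrig (d K : ℕ) (v : Coef d) : Prop := ∀ j, ¬ inK d K j → v j = 0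

/-- The function is real-valued: conjugate-symmetric Fourier coefficients. -/
def isReal {d : ℕ} (v : Coef d) : Prop := ∀ j, v (-j) = (starRingEnd ℂ) (v j)

open Classical in
/-- Trigonometric interpolation `𝓘` of degree `K` at the collocation points
`x_k = kπ/K`, expressed through aliasing of Fourier coefficients. -/
def interp (d K : ℕ) (v : Coef d) : Coef d := fun j =>
  if inK d K j then ∑' m : Fin d → ℤ, v (j + (2 * (K : ℤ)) • m) else 0

/-- Fourier multiplier with symbol `g(|j|)`. -/
def mulOp {d : ℕ} (g : ℝ → ℂ) (v : Coef d) : Coef d := fun j => g (absZ j) * v j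

/-- `sinc ξ = sin ξ / ξ`, `sinc 0 = 1`. -/
def sinc (x : ℝ) : ℝ := if x = 0 then 1 else Real.sin x / x

/-- Convolution powers `v^{*n}` (with `v^{*0} = δ₀`). -/
def convPow {d : ℕ} (v : Coef d) : ℕ → Coef d
  | 0 => fun j => if j = 0 then 1 else 0
  | n + 1 => conv v (convPow v n)

/-- Composition with the exponential: Fourier coefficients of `e^{v}`. -/
def expC {d : ℕ} (v : Coef d) : Coef d :=
  fun j => ∑' n : ℕ, ((n.factorial : ℂ))⁻¹ * convPow v n j

/-- Composition with `ϕ(ξ) = (e^ξ - 1)/ξ = ∑ ξ^n/(n+1)!`. -/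
def phiC {d : ℕ} (v : Coef d) : Coef d :=
  fun j => ∑' n : ℕ, (((n + 1).factorial : ℂ))⁻¹ * convPow v n j

/-- The wave propagator matrix
`R(t) = [[cos(tΩ), t sinc(tΩ)], [-Ω sin(tΩ), cos(tΩ)]]`. -/
def Rop {d : ℕ} (t : ℝ) (p : Coef d × Coef d) : Coef d × Coef d :=
  (fun j => ((Real.cos (t * absZ j) : ℝ) : ℂ) * p.1 j
      + ((t * sinc (t * absZ j) : ℝ) : ℂ) * p.2 j,
   fun j => -(((absZ j * Real.sin (t * absZ j) : ℝ)) : ℂ) * p.1 j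
      + ((Real.cos (t * absZ j) : ℝ) : ℂ) * p.2 j)

/-- The operator `(Ω² ϕ(iτΩ²) + 1)⁻¹`, multiplying the `j`-th Fourier coefficient
by `iτ/(e^{iτ|j|²} - 1 + iτ)`. -/
def poissonInv (d : ℕ) (τ : ℝ) (v : Coef d) : Coef d :=
  fun j => (Complex.I * (τ : ℂ) /
      (Complex.exp (Complex.I * (τ : ℂ) * ((absZ j : ℝ) : ℂ) ^ 2) - 1 + Complex.I * (τ : ℂ))) * v j

/-- The operator `(Ω² + 1)⁻¹ = (-Δ + 1)⁻¹`. -/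
def laplInv (d : ℕ) (v : Coef d) : Coef d :=
  fun j => ((((absZ j) ^ 2 + 1 : ℝ)) : ℂ)⁻¹ * v j

/-- The free Schrödinger propagator `e^{-iτΩ²} = e^{iτΔ}`. -/
def freeOp {d : ℕ} (τ : ℝ) : Coef d → Coef d :=
  mulOp (fun x => Complex.exp (-Complex.I * (τ : ℂ) * ((x : ℂ)) ^ 2))

/-- The inverse free propagator `e^{iτΩ²}`. -/
def freeOpInv {d : ℕ} (τ : ℝ) : Coef d → Coef d :=
  mulOp (fun x => Complex.exp (Complex.I * (τ : ℂ) * ((x : ℂ)) ^ 2))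

/-- The operator `sinc(τΩ)`. -/
def sincOp {d : ℕ} (τ : ℝ) : Coef d → Coef d := mulOp (fun x => ((sinc (τ * x) : ℝ) : ℂ))

/-- The operator `sinc(τΩ/2)²`. -/
def sincHalfSqOp {d : ℕ} (τ : ℝ) : Coef d → Coef d :=
  mulOp (fun x => ((sinc (τ * x / 2) ^ 2 : ℝ) : ℂ))

/-- The operator `sinc(τΩ) - 1`. -/
def sincm1Op {d : ℕ} (τ : ℝ) : Coef d → Coef d := mulOp (fun x => ((sinc (τ * x) - 1 : ℝ) : ℂ))

/-- The Zakharov system in first-order form, `i∂_tψ = -Δψ + uψ`, `∂_t u = u̇`,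
`∂_t u̇ = Δu + Δ|ψ|²`, with `u`, `u̇` real-valued, formulated mode-wise for the
Fourier coefficients. -/
def ZakSol (d : ℕ) (ψ u ud : ℝ → Coef d) : Prop :=
  (∀ t j, HasDerivAt (fun r => ψ r j)
      (-Complex.I * (((absZ j ^ 2 : ℝ) : ℂ) * ψ t j + conv (u t) (ψ t) j)) t) ∧
  (∀ t j, HasDerivAt (fun r => u r j) (ud t j) t) ∧
  (∀ t j, HasDerivAt (fun r => ud r j)
      (-((absZ j ^ 2 : ℝ) : ℂ) * (u t j + absSq (ψ t) j)) t) ∧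
  (∀ t, isReal (u t)) ∧ (∀ t, isReal (ud t))

/-- The Fourier collocation semi-discretization in space of the Zakharov system:
`i∂_tψ^K = -Δψ^K + 𝓘(u^K ψ^K)`, `∂_t u^K = u̇^K`, `∂_t u̇^K = Δu^K + Δ𝓘(|ψ^K|²)`
for trigonometric polynomials of degree `K`. -/
def ZakSolK (d K : ℕ) (ψ u ud : ℝ → Coef d) : Prop :=
  (∀ t, isTrig d K (ψ t) ∧ isTrig d K (u t) ∧ isTrig d K (ud t)) ∧
  (∀ t j, HasDerivAt (fun r => ψ r j)
      (-Complex.I * (((absZ j ^ 2 : ℝ) : ℂ) * ψ t j + interp d K (conv (u t) (ψ t)) j)) t) ∧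
  (∀ t j, HasDerivAt (fun r => u r j) (ud t j) t) ∧
  (∀ t j, HasDerivAt (fun r => ud r j)
      (-((absZ j ^ 2 : ℝ) : ℂ) * (u t j + interp d K (absSq (ψ t)) j)) t)

/-- Interpolated initial values `ψ^K(t₀) = 𝓘(ψ(t₀))` etc. -/
def initK (d K : ℕ) (t₀ : ℝ) (ψ u ud ψK uK udK : ℝ → Coef d) : Prop :=
  ψK t₀ = interp d K (ψ t₀) ∧ uK t₀ = interp d K (u t₀) ∧ udK t₀ = interp d K (ud t₀)

/-- The new variable `φ = ∂_tψ`, expressed via the Schrödinger equation. -/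
def phiEx (d : ℕ) (ψ u : ℝ → Coef d) : ℝ → Coef d :=
  fun t j => -Complex.I * (((absZ j ^ 2 : ℝ) : ℂ) * ψ t j + conv (u t) (ψ t) j)

/-- The semi-discrete new variable `φ^K = ∂_tψ^K`, expressed via the semi-discrete
Schrödinger equation. -/
def phiK (d K : ℕ) (ψ u : ℝ → Coef d) : ℝ → Coef d :=
  fun t j => -Complex.I * (((absZ j ^ 2 : ℝ) : ℂ) * ψ t j + interp d K (conv (u t) (ψ t)) j)

/-- Regularity assumption `‖ψ(t)‖_{s+2+σ} + |||(u(t),u̇(t))|||_{s+σ} ≤ M` on `[t₀, t₀+T]`. -/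
def regBound (d : ℕ) (s σ M T t₀ : ℝ) (ψ u ud : ℝ → Coef d) : Prop :=
  ∀ t, t₀ ≤ t → t ≤ t₀ + T → sobNorm (s + 2 + σ) (ψ t) + pairNorm (s + σ) (u t) (ud t) ≤ M

/-- The CFL-type step-size restriction `d τ K² ≤ c`. -/
def CFL (d K : ℕ) (τ c : ℝ) : Prop := (d : ℝ) * τ * (K : ℝ) ^ 2 ≤ c

/-- The semi-discretization error quantity
`e(t) = sup_{t₀ ≤ t' ≤ t} (‖φ(t')-φ^K(t')‖ₛ + |||(u,u̇)(t') - (u^K,u̇^K)(t')|||ₛ)`. -/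
def errSemi (d K : ℕ) (s t₀ : ℝ) (ψ u ud ψK uK udK : ℝ → Coef d) (t : ℝ) : ℝ :=
  sSup ((fun r =>
    sobNorm s (phiEx d ψ u r - phiK d K ψK uK r)
      + pairNorm s (u r - uK r) (ud r - udK r)) '' Set.Icc t₀ t)

/-- `v_{n+1}^K = sinc(τΩ) u_n^K + (τ/2) sinc(τΩ/2)² u̇_n^K + (sinc(τΩ)-1) 𝓘(|ψ_n^K|²)`. -/
def vOrig (d K : ℕ) (τ : ℝ) (u ud ψ : Coef d) : Coef d :=
  sincOp τ u + ((τ / 2 : ℝ) : ℂ) • sincHalfSqOp τ ud + sincm1Op τ (interp d K (absSq ψ))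

/-- `ψ_{n+1}^K = e^{-iτΩ²} 𝓘(e^{-iτ v} ψ_n^K)`. -/
def psiStep (d K : ℕ) (τ : ℝ) (v ψ : Coef d) : Coef d :=
  freeOp τ (interp d K (conv (expC ((-Complex.I * (τ : ℂ)) • v)) ψ))

/-- `(u_{n+1}, u̇_{n+1}) = R(τ)(u_n, u̇_n) + (R(τ)-1)(q, 0)`. -/
def uStep {d : ℕ} (τ : ℝ) (u ud q : Coef d) : Coef d × Coef d :=
  ((Rop τ (u, ud)).1 + (Rop τ (q, 0)).1 - q, (Rop τ (u, ud)).2 + (Rop τ (q, 0)).2)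

/-- The Lie–Trotter splitting method of Jin, Markowich and Zheng. -/
def LieTrotter (d K : ℕ) (τ : ℝ) (ψn un udn : ℕ → Coef d) : Prop :=
  ∀ n : ℕ,
    ψn (n + 1) = psiStep d K τ (vOrig d K τ (un n) (udn n) (ψn n)) (ψn n) ∧
    un (n + 1) = (uStep τ (un n) (udn n) (interp d K (absSq (ψn n)))).1 ∧
    udn (n + 1) = (uStep τ (un n) (udn n) (interp d K (absSq (ψn n)))).2

/-- Interpolated starting values for the fully discrete method. -/
def initFull (d K : ℕ) (t₀ : ℝ) (ψ u ud : ℝ → Coef d) (ψn un udn : ℕ → Coef d) : Prop :=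
  ψn 0 = interp d K (ψ t₀) ∧ un 0 = interp d K (u t₀) ∧ udn 0 = interp d K (ud t₀)

/-- Discrete new variable `φ_n^K = (ψ_n^K - ψ_{n-1}^K)/τ`. -/
def phin {d : ℕ} (τ : ℝ) (ψn : ℕ → Coef d) (n : ℕ) : Coef d :=
  ((τ : ℂ))⁻¹ • (ψn n - ψn (n - 1))

/-- `v = sinc(τΩ) u - (τ/2) sinc(τΩ/2)² u̇ + (sinc(τΩ)-1) 𝓘(|p|²)` (new variables). -/
def vNew (d K : ℕ) (τ : ℝ) (u ud p : Coef d) : Coef d :=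
  sincOp τ u - ((τ / 2 : ℝ) : ℂ) • sincHalfSqOp τ ud + sincm1Op τ (interp d K (absSq p))

/-- `w = sinc(τΩ/2)² u̇ + (sinc(τΩ)-1) 𝓘(Re((p_cur + p_prev) conj φ))`. -/
def wNew (d K : ℕ) (τ : ℝ) (ud pcur pprev φ : Coef d) : Coef d :=
  sincHalfSqOp τ ud + sincm1Op τ (interp d K (reC (conv (pcur + pprev) (conjC φ))))

/-- One step of the method in the new variables:
`φ ↦ e^{-iτΩ²} 𝓘(e^{-iτv} (φ - iτ w ϕ(-iτ²w) p))`. -/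
def phiStepNew (d K : ℕ) (τ : ℝ) (v w φ p : Coef d) : Coef d :=
  freeOp τ (interp d K (conv (expC ((-Complex.I * (τ : ℂ)) • v))
    (φ - (Complex.I * (τ : ℂ)) • conv w (conv (phiC ((-Complex.I * (τ : ℂ) ^ 2) • w)) p))))

/-- `ψ_P = (Ω²ϕ(iτΩ²)+1)⁻¹ 𝓘(iφ + p - v ϕ(iτv) e^{iτΩ²} p)`. -/
def psiPNew (d K : ℕ) (τ : ℝ) (φ p v : Coef d) : Coef d :=
  poissonInv d τ (interp d K (Complex.I • φ + p -
    conv v (conv (phiC ((Complex.I * (τ : ℂ)) • v)) (freeOpInv τ p))))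

/-- Discrete new variable `v_n^K`. -/
def vn (d K : ℕ) (τ : ℝ) (ψn un udn : ℕ → Coef d) (n : ℕ) : Coef d :=
  vNew d K τ (un n) (udn n) (ψn (n - 1))

/-- Discrete new variable `w_n^K`. -/
def wn (d K : ℕ) (τ : ℝ) (ψn un udn : ℕ → Coef d) (n : ℕ) : Coef d :=
  wNew d K τ (udn n) (ψn n) (ψn (n - 1)) (phin τ ψn n)

/-- Discrete new variable `ψ_{P,n}^K` (with `ψ_{P,0}^K = ψ₀^K`). -/
def psiPn (d K : ℕ) (τ : ℝ) (ψn un udn : ℕ → Coef d) (n : ℕ) : Coef d :=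
  if n = 0 then ψn 0 else
    psiPNew d K τ (phin τ ψn n) (ψn n) (vn d K τ ψn un udn n)

/-- Intermediate quantity `ψ̂_{I,n}^K = ψ₀^K + τ(φ^K(t₁) + … + φ^K(t_n))`. -/
def psiIhat (d K : ℕ) (τ t₀ : ℝ) (ψK uK : ℝ → Coef d) (n : ℕ) : Coef d :=
  ψK t₀ + (τ : ℂ) • ∑ m ∈ Finset.range n, phiK d K ψK uK (t₀ + ((m : ℝ) + 1) * τ)

/-- Intermediate quantity `v̂_n^K`. -/
def vhat (d K : ℕ) (τ t₀ : ℝ) (ψK uK udK : ℝ → Coef d) (n : ℕ) : Coef d :=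
  vNew d K τ (uK (t₀ + (n : ℝ) * τ)) (udK (t₀ + (n : ℝ) * τ)) (psiIhat d K τ t₀ ψK uK (n - 1))

/-- Intermediate quantity `ŵ_n^K`. -/
def what (d K : ℕ) (τ t₀ : ℝ) (ψK uK udK : ℝ → Coef d) (n : ℕ) : Coef d :=
  wNew d K τ (udK (t₀ + (n : ℝ) * τ)) (psiIhat d K τ t₀ ψK uK n)
    (psiIhat d K τ t₀ ψK uK (n - 1)) (phiK d K ψK uK (t₀ + (n : ℝ) * τ))

/-- Intermediate quantity `φ̂_{n+1}^K` (as a function of `n`). -/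
def phihatSucc (d K : ℕ) (τ t₀ : ℝ) (ψK uK udK : ℝ → Coef d) (n : ℕ) : Coef d :=
  phiStepNew d K τ (vhat d K τ t₀ ψK uK udK n) (what d K τ t₀ ψK uK udK n)
    (phiK d K ψK uK (t₀ + (n : ℝ) * τ)) (psiIhat d K τ t₀ ψK uK n)

/-- Intermediate quantity `ψ̂_{P,n}^K` (with `ψ̂_{P,0}^K = ψ₀^K`). -/
def psiPhat (d K : ℕ) (τ t₀ : ℝ) (ψK uK udK : ℝ → Coef d) (n : ℕ) : Coef d :=
  if n = 0 then ψK t₀ else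
    psiPNew d K τ (phiK d K ψK uK (t₀ + (n : ℝ) * τ)) (psiIhat d K τ t₀ ψK uK n)
      (vhat d K τ t₀ ψK uK udK n)

/-- Intermediate quantity `(û_{n+1}^K, û̇_{n+1}^K)` (as a function of `n`). -/
def uhatSucc (d K : ℕ) (τ t₀ : ℝ) (ψK uK udK : ℝ → Coef d) (n : ℕ) : Coef d × Coef d :=
  uStep τ (uK (t₀ + (n : ℝ) * τ)) (udK (t₀ + (n : ℝ) * τ))
    (interp d K (absSq (psiPhat d K τ t₀ ψK uK udK n)))

/-- The fully discrete error quantity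
`e_n^K = max_{1 ≤ j ≤ n} (‖φ^K(t_j) - φ_j^K‖ₛ + |||(u^K,u̇^K)(t_j) - (u_j^K,u̇_j^K)|||ₛ)`,
with `e₀^K = 0`. -/
def errFull (d K : ℕ) (s τ t₀ : ℝ) (ψK uK udK : ℝ → Coef d)
    (ψn un udn : ℕ → Coef d) (n : ℕ) : ℝ :=
  sSup ((fun m : ℕ =>
    sobNorm s (phiK d K ψK uK (t₀ + (m : ℝ) * τ) - phin τ ψn m)
      + pairNorm s (uK (t₀ + (m : ℝ) * τ) - un m) (udK (t₀ + (m : ℝ) * τ) - udn m))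
    '' Set.Icc 1 n)

/-- Higher-order regularity bound on the semi-discrete solution (with constant `C₀`). -/
def regHighK (d K : ℕ) (s C₀ T t₀ : ℝ) (ψK uK udK : ℝ → Coef d) : Prop :=
  ∀ t, t₀ ≤ t → t ≤ t₀ + T →
    sobNorm (s + 4) (ψK t) + pairNorm (s + 2) (uK t) (udK t)
      + sobNorm (s + 2) (phiK d K ψK uK t) ≤ C₀

/-- A priori bound `‖φ_n^K‖ₛ + |||(u_n^K,u̇_n^K)|||ₛ ≤ B` for `τ ≤ t_n - t₀ ≤ T`
on the fully discrete solution. -/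
def aprioriFull {d : ℕ} (s B T τ : ℝ) (ψn un udn : ℕ → Coef d) : Prop :=
  ∀ n : ℕ, 1 ≤ n → (n : ℝ) * τ ≤ T →
    sobNorm s (phin τ ψn n) + pairNorm s (un n) (udn n) ≤ B



/-! ### Absolutely summable coefficient sequences and characters -/

/-- Absolutely summable coefficients. -/
def Ss {d : ℕ} (v : Coef d) : Prop := Summable fun j => ‖v j‖

/-- The `ℓ¹` norm. -/
def nrm1 {d : ℕ} (v : Coef d) : ℝ := ∑' j, ‖v j‖

/-- The shear `(j,k) ↦ (k, j-k)`. -/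
def shear (d : ℕ) : ((Fin d → ℤ) × (Fin d → ℤ)) ≃ ((Fin d → ℤ) × (Fin d → ℤ)) where
  toFun p := (p.2, p.1 - p.2)
  invFun p := (p.1 + p.2, p.1)
  left_inv p := by ext <;> simp
  right_inv p := by ext <;> simp

lemma summable_shear {d : ℕ} {a b : Coef d} (ha : Ss a) (hb : Ss b) :
    Summable fun p : (Fin d → ℤ) × (Fin d → ℤ) => ‖a p.2 * b (p.1 - p.2)‖ :=
  (shear d).summable_iff.2 (Summable.mul_norm ha hb)

lemma Ss.conv {d : ℕ} {a b : Coef d} (ha : Ss a) (hb : Ss b) : Ss (conv a b) := by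
  have h := summable_shear ha hb
  refine Summable.of_nonneg_of_le (fun j => norm_nonneg _) (fun j => ?_) h.prod
  exact norm_tsum_le_tsum_norm (h.prod_factor j)

lemma nrm1_conv {d : ℕ} {a b : Coef d} (ha : Ss a) (hb : Ss b) :
    nrm1 (Zak.conv a b) ≤ nrm1 a * nrm1 b := by
  have h := summable_shear ha hb
  have h1 : nrm1 (Zak.conv a b) ≤ ∑' j, ∑' k, ‖a k * b (j - k)‖ :=
    Summable.tsum_le_tsum (fun j => norm_tsum_le_tsum_norm (h.prod_factor j)) (ha.conv hb) h.prod
  have h2 : ∑' j, ∑' k, ‖a k * b (j - k)‖ = nrm1 a * nrm1 b := by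
    rw [← h.tsum_prod (f := fun p : (Fin d → ℤ) × (Fin d → ℤ) => ‖a p.2 * b (p.1 - p.2)‖)]
    rw [nrm1, nrm1, tsum_mul_tsum_of_summable_norm (by simpa [Ss] using ha) (by simpa [Ss] using hb)]
    rw [← (shear d).tsum_eq (fun z => ‖a z.1‖ * ‖b z.2‖)]
    simp [shear]
  exact h1.trans h2.le

lemma nrm1_nonneg {d : ℕ} (a : Coef d) : 0 ≤ nrm1 a := tsum_nonneg fun _ => norm_nonneg _

lemma Ss.convPow {d : ℕ} {a : Coef d} (ha : Ss a) (n : ℕ) :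
    Ss (convPow a n) ∧ nrm1 (convPow a n) ≤ nrm1 a ^ n := by
  induction n with
  | zero =>
    have : (fun j => ‖(Zak.convPow a 0) j‖) = fun j => if j = 0 then (1 : ℝ) else 0 := by
      funext j; simp only [Zak.convPow]; split_ifs <;> simp
    constructor
    · rw [Ss, this]; exact summable_of_ne_finset_zero (s := {0}) (by intro b hb; simp at hb; simp [hb])
    · rw [nrm1, this]; simp
  | succ n ih =>
    refine ⟨ha.conv ih.1, (nrm1_conv ha ih.1).trans ?_⟩
    rw [pow_succ']
    exact mul_le_mul_of_nonneg_left ih.2 (nrm1_nonneg _)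

/-- A power series composed with a function. -/
def serC {d : ℕ} (c : ℕ → ℂ) (a : Coef d) : Coef d := fun j => ∑' n : ℕ, c n * convPow a n j

lemma summable_ser {d : ℕ} {c : ℕ → ℂ} (hc : ∀ n, ‖c n‖ ≤ ((n.factorial : ℝ))⁻¹)
    {a : Coef d} (ha : Ss a) :
    Summable fun p : ℕ × (Fin d → ℤ) => ‖c p.1 * convPow a p.1 p.2‖ := by
  rw [summable_prod_of_nonneg (fun p => norm_nonneg _)]
  refine ⟨fun n => ?_, ?_⟩
  · simp only [norm_mul]; exact (ha.convPow n).1.mul_left _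
  · simp only [norm_mul, tsum_mul_left]
    refine Summable.of_nonneg_of_le (fun n => mul_nonneg (norm_nonneg _) (nrm1_nonneg _)) (fun n => ?_)
      (Real.summable_pow_div_factorial (nrm1 a))
    rw [div_eq_inv_mul]
    exact mul_le_mul (hc n) (ha.convPow n).2 (nrm1_nonneg _) (by positivity)

lemma Ss.ser {d : ℕ} {c : ℕ → ℂ} (hc : ∀ n, ‖c n‖ ≤ ((n.factorial : ℝ))⁻¹)
    {a : Coef d} (ha : Ss a) : Ss (serC c a) := by
  have h := (summable_ser hc ha).prod_symm
  refine Summable.of_nonneg_of_le (fun j => norm_nonneg _) (fun j => ?_) h.prod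
  exact norm_tsum_le_tsum_norm (h.prod_factor j)

section chars

variable {d : ℕ} {A : Type*} [NormedCommRing A] [NormedAlgebra ℂ A] [CompleteSpace A]

/-- A bounded multiplicative character of `ℤ^d` with values in a Banach algebra. -/
structure IsChar (e : (Fin d → ℤ) → A) : Prop where
  zero : e 0 = 1
  add : ∀ j k, e (j + k) = e j * e k
  bdd : ∃ B, ∀ j, ‖e j‖ ≤ B

/-- Evaluation on a character. -/
def PP (e : (Fin d → ℤ) → A) (v : Coef d) : A := ∑' j, v j • e j

lemma IsChar.summable_norm {e : (Fin d → ℤ) → A} (he : IsChar e) {v : Coef d} (hv : Ss v) :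
    Summable fun j => ‖v j • e j‖ := by
  obtain ⟨B, hB⟩ := he.bdd
  refine Summable.of_nonneg_of_le (fun j => norm_nonneg _) (fun j => ?_) (hv.mul_right B)
  rw [norm_smul]; exact mul_le_mul_of_nonneg_left (hB j) (norm_nonneg _)

lemma IsChar.summable {e : (Fin d → ℤ) → A} (he : IsChar e) {v : Coef d} (hv : Ss v) :
    Summable fun j => v j • e j := (he.summable_norm hv).of_norm

lemma Ss.add {v w : Coef d} (hv : Ss v) (hw : Ss w) : Ss (v + w) :=
  Summable.of_nonneg_of_le (fun j => norm_nonneg _) (fun j => norm_add_le _ _) (Summable.add hv hw)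
lemma Ss.neg {v : Coef d} (hv : Ss v) : Ss (-v) := by simpa [Ss] using hv
lemma Ss.sub {v w : Coef d} (hv : Ss v) (hw : Ss w) : Ss (v - w) := by
  rw [sub_eq_add_neg]; exact hv.add hw.neg
lemma Ss.smul {v : Coef d} (z : ℂ) (hv : Ss v) : Ss (z • v) := by
  simpa [Ss] using Summable.mul_left ‖z‖ hv

lemma IsChar.map_add {e : (Fin d → ℤ) → A} (he : IsChar e) {v w : Coef d} (hv : Ss v) (hw : Ss w) :
    PP e (v + w) = PP e v + PP e w := by
  rw [PP, PP, PP, ← (he.summable hv).tsum_add (he.summable hw)]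
  simp [add_smul]

lemma PP_neg (e : (Fin d → ℤ) → A) (v : Coef d) : PP e (-v) = -PP e v := by
  rw [PP, PP, ← tsum_neg]; simp

lemma IsChar.map_sub {e : (Fin d → ℤ) → A} (he : IsChar e) {v w : Coef d} (hv : Ss v) (hw : Ss w) :
    PP e (v - w) = PP e v - PP e w := by
  rw [sub_eq_add_neg, he.map_add hv hw.neg, PP_neg, sub_eq_add_neg]

lemma IsChar.map_smul {e : (Fin d → ℤ) → A} (he : IsChar e) (z : ℂ) {v : Coef d} (hv : Ss v) :
    PP e (z • v) = z • PP e v := by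
  rw [PP, PP, ← (he.summable hv).tsum_const_smul]
  simp [smul_smul]

lemma IsChar.map_conv {e : (Fin d → ℤ) → A} (he : IsChar e) {a b : Coef d} (ha : Ss a) (hb : Ss b) :
    PP e (conv a b) = PP e a * PP e b := by
  rw [PP, PP, PP, tsum_mul_tsum_of_summable_norm (he.summable_norm ha) (he.summable_norm hb)]
  rw [← (shear d).tsum_eq]
  have hs : Summable fun p : (Fin d → ℤ) × (Fin d → ℤ) =>
      (fun z : (Fin d → ℤ) × (Fin d → ℤ) => (a z.1 • e z.1) * (b z.2 • e z.2)) (shear d p) :=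
    (shear d).summable_iff.2
      (summable_mul_of_summable_norm (he.summable_norm ha) (he.summable_norm hb))
  rw [hs.tsum_prod]
  refine tsum_congr fun j => ?_
  have h := (summable_shear ha hb).of_norm.prod_factor j
  simp only at h
  rw [conv, ← h.tsum_smul_const]
  refine tsum_congr fun k => ?_
  simp only [shear, Equiv.coe_fn_mk]
  rw [smul_mul_smul_comm, ← he.add, add_sub_cancel]

lemma IsChar.map_convPow {e : (Fin d → ℤ) → A} (he : IsChar e) {a : Coef d} (ha : Ss a) (n : ℕ) :
    PP e (convPow a n) = PP e a ^ n := by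
  induction n with
  | zero =>
    rw [PP, tsum_eq_single 0]
    · simp [convPow, he.zero]
    · intro j hj; simp [convPow, hj]
  | succ n ih =>
    rw [convPow, he.map_conv ha (ha.convPow n).1, ih, pow_succ']

lemma IsChar.map_ser {e : (Fin d → ℤ) → A} (he : IsChar e) {c : ℕ → ℂ}
    (hc : ∀ n, ‖c n‖ ≤ ((n.factorial : ℝ))⁻¹) {a : Coef d} (ha : Ss a) :
    PP e (serC c a) = ∑' n, c n • PP e a ^ n := by
  have h := summable_ser hc ha
  obtain ⟨B, hB⟩ := he.bdd
  have h2 : Summable fun p : ℕ × (Fin d → ℤ) => (c p.1 * convPow a p.1 p.2) • e p.2 := by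
    apply Summable.of_norm
    refine Summable.of_nonneg_of_le (fun j => norm_nonneg _) (fun j => ?_) (h.mul_right B)
    rw [norm_smul]; exact mul_le_mul_of_nonneg_left (hB _) (norm_nonneg _)
  have h3 := Summable.tsum_comm
    (f := fun (n : ℕ) (j : Fin d → ℤ) => (c n * convPow a n j) • e j) h2
  have h4 : PP e (serC c a) = ∑' (j : Fin d → ℤ) (n : ℕ), (c n * convPow a n j) • e j := by
    rw [PP]
    refine tsum_congr fun j => ?_
    have := h.of_norm.prod_symm.prod_factor j
    rw [serC]
    exact (Summable.tsum_smul_const this _).symm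
  rw [h4, h3]
  refine tsum_congr fun n => ?_
  rw [← he.map_convPow ha, PP, ← (he.summable (ha.convPow n).1).tsum_const_smul]
  simp [smul_smul]

lemma Ss.expC {a : Coef d} (ha : Ss a) : Ss (expC a) :=
  Ss.ser (c := fun n => ((n.factorial : ℂ))⁻¹) (by simp) ha

lemma phi_coef_le (n : ℕ) : ‖(((n + 1).factorial : ℂ))⁻¹‖ ≤ ((n.factorial : ℝ))⁻¹ := by
  rw [norm_inv, Complex.norm_natCast]
  apply inv_anti₀ (by positivity)
  exact_mod_cast Nat.factorial_le (Nat.le_succ n)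

lemma Ss.phiC {a : Coef d} (ha : Ss a) : Ss (phiC a) :=
  Ss.ser (c := fun n => (((n + 1).factorial : ℂ))⁻¹) phi_coef_le ha

lemma IsChar.map_expC {e : (Fin d → ℤ) → A} (he : IsChar e) {a : Coef d} (ha : Ss a) :
    PP e (Zak.expC a) = NormedSpace.exp (PP e a) := by
  have := he.map_ser (c := fun n => ((n.factorial : ℂ))⁻¹) (by simp) ha
  rw [← (NormedSpace.exp_series_hasSum_exp' (𝕂 := ℂ) (PP e a)).tsum_eq, ← this]
  rfl

lemma IsChar.map_phiC {e : (Fin d → ℤ) → A} (he : IsChar e) {a : Coef d} (ha : Ss a) :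
    PP e a * PP e (Zak.phiC a) = NormedSpace.exp (PP e a) - 1 := by
  have h1 : PP e (Zak.phiC a) = ∑' n, (((n + 1).factorial : ℂ))⁻¹ • PP e a ^ n :=
    he.map_ser (c := fun n => (((n + 1).factorial : ℂ))⁻¹) phi_coef_le ha
  have hs := NormedSpace.exp_series_hasSum_exp' (𝕂 := ℂ) (PP e a)
  have hs2 : Summable fun n => (((n + 1).factorial : ℂ))⁻¹ • PP e a ^ n := by
    apply Summable.of_norm
    refine Summable.of_nonneg_of_le (fun j => norm_nonneg _) (fun n => ?_)
      (NormedSpace.norm_expSeries_summable' (𝕂 := ℂ) (PP e a))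
    rw [norm_smul, norm_smul]
    gcongr
    refine (phi_coef_le n).trans ?_
    simp
  rw [h1, ← hs2.tsum_mul_left, ← hs.tsum_eq, hs.summable.tsum_eq_zero_add]
  simp [pow_succ']

/-- Bound for `exp x - 1` in a Banach algebra. -/
lemma norm_exp_sub_one_le (x : A) :
    ‖NormedSpace.exp x - 1‖ ≤ ‖x‖ * Real.exp ‖x‖ := by
  have hs := NormedSpace.exp_series_hasSum_exp' (𝕂 := ℂ) x
  have h1 : NormedSpace.exp x - 1 = ∑' n : ℕ, (((n + 1).factorial : ℂ))⁻¹ • x ^ (n + 1) := by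
    rw [← hs.tsum_eq, hs.summable.tsum_eq_zero_add]; simp
  have hr : HasSum (fun n : ℕ => ‖x‖ * (‖x‖ ^ n / n.factorial)) (‖x‖ * Real.exp ‖x‖) := by
    apply HasSum.mul_left
    rw [Real.exp_eq_exp_ℝ]
    exact NormedSpace.expSeries_div_hasSum_exp ‖x‖
  rw [h1]
  refine tsum_of_norm_bounded hr fun n => ?_
  rw [norm_smul]
  have h2 : ‖x ^ (n + 1)‖ ≤ ‖x‖ ^ (n + 1) := norm_pow_le' x (Nat.succ_pos n)
  calc _ ≤ ((n.factorial : ℝ))⁻¹ * ‖x‖ ^ (n + 1) :=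
        mul_le_mul (phi_coef_le n) h2 (norm_nonneg _) (by positivity)
    _ = _ := by rw [pow_succ']; ring

/-- Local Lipschitz bound for `z ↦ (exp(z v) - 1) x`. -/
lemma exp_lip (z : ℂ) (v v' x x' : A) (D : ℝ) (hv : ‖z‖ * ‖v‖ ≤ D) (hv' : ‖z‖ * ‖v'‖ ≤ D) :
    ‖(NormedSpace.exp (z • v) - 1) * x - (NormedSpace.exp (z • v') - 1) * x'‖
      ≤ ‖z‖ * ((1 + D * Real.exp D) * Real.exp (2 * D) * ‖v - v'‖ * ‖x‖
        + ‖v'‖ * Real.exp D * ‖x - x'‖) := by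
  letI : NormedAlgebra ℚ A := NormedAlgebra.restrictScalars ℚ ℂ A
  have hD : 0 ≤ D := (mul_nonneg (norm_nonneg _) (norm_nonneg _)).trans hv
  have e1 : NormedSpace.exp (z • v)
      = NormedSpace.exp (z • v') * NormedSpace.exp (z • (v - v')) := by
    rw [← NormedSpace.exp_add, ← smul_add, add_sub_cancel]
  have e2 : (NormedSpace.exp (z • v) - 1) * x - (NormedSpace.exp (z • v') - 1) * x'
      = (NormedSpace.exp (z • (v - v')) - 1) * x
        + (NormedSpace.exp (z • v') - 1) * ((NormedSpace.exp (z • (v - v')) - 1) * x)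
        + (NormedSpace.exp (z • v') - 1) * (x - x') := by
    rw [e1]; ring
  have n1 := norm_exp_sub_one_le (z • (v - v'))
  have n2 := norm_exp_sub_one_le (z • v')
  rw [norm_smul] at n1 n2
  have hvv : ‖z‖ * ‖v - v'‖ ≤ 2 * D := by
    calc ‖z‖ * ‖v - v'‖ ≤ ‖z‖ * (‖v‖ + ‖v'‖) := by gcongr; exact norm_sub_le _ _
      _ ≤ 2 * D := by linarith
  have n1' : ‖NormedSpace.exp (z • (v - v')) - 1‖ ≤ ‖z‖ * ‖v - v'‖ * Real.exp (2 * D) :=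
    n1.trans (by gcongr)
  have n2' : ‖NormedSpace.exp (z • v') - 1‖ ≤ ‖z‖ * ‖v'‖ * Real.exp D := n2.trans (by gcongr)
  have n2'' : ‖NormedSpace.exp (z • v') - 1‖ ≤ D * Real.exp D := n2'.trans (by gcongr)
  have m1 : ‖(NormedSpace.exp (z • (v - v')) - 1) * x‖
      ≤ ‖z‖ * ‖v - v'‖ * Real.exp (2 * D) * ‖x‖ :=
    (norm_mul_le _ _).trans (by gcongr)
  rw [e2]
  refine (norm_add₃_le).trans ?_
  have m2 := (norm_mul_le (NormedSpace.exp (z • v') - 1)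
    ((NormedSpace.exp (z • (v - v')) - 1) * x)).trans
    (mul_le_mul n2'' m1 (norm_nonneg _) (by positivity))
  have m3 := (norm_mul_le (NormedSpace.exp (z • v') - 1) (x - x')).trans
    (mul_le_mul_of_nonneg_right n2' (norm_nonneg _))
  calc _ ≤ _ := add_le_add (add_le_add m1 m2) m3
    _ = _ := by ring

end chars


/-! ### Weights on the finite quotient group -/

lemma absZ_nonneg {d : ℕ} (j : Fin d → ℤ) : 0 ≤ absZ j := Real.sqrt_nonneg _

lemma absZ_eq_norm {d : ℕ} (j : Fin d → ℤ) :
    absZ j = ‖(WithLp.toLp 2 (fun i => (j i : ℝ)) : EuclideanSpace ℝ (Fin d))‖ := by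
  rw [EuclideanSpace.norm_eq, absZ]; simp

lemma absZ_add_le {d : ℕ} (j k : Fin d → ℤ) : absZ (j + k) ≤ absZ j + absZ k := by
  rw [absZ_eq_norm, absZ_eq_norm, absZ_eq_norm]
  refine le_trans (le_of_eq ?_) (norm_add_le _ _)
  congr 1
  ext i; simp

lemma absZ_mono {d : ℕ} {j k : Fin d → ℤ} (h : ∀ i, |j i| ≤ |k i|) : absZ j ≤ absZ k := by
  apply Real.sqrt_le_sqrt
  refine Finset.sum_le_sum fun i _ => ?_
  have : |(j i : ℝ)| ≤ |(k i : ℝ)| := by exact_mod_cast h i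
  exact sq_le_sq.2 this

lemma absZ_neg {d : ℕ} (j : Fin d → ℤ) : absZ (-j) = absZ j := by simp [absZ]

lemma abs_le_absZ {d : ℕ} (j : Fin d → ℤ) (i : Fin d) : |(j i : ℝ)| ≤ absZ j := by
  rw [← Real.sqrt_sq_eq_abs]
  apply Real.sqrt_le_sqrt
  exact Finset.single_le_sum (f := fun i => ((j i : ℝ)) ^ 2) (fun i _ => sq_nonneg _)
    (Finset.mem_univ i)

/-- The weight `max(|j|,1)`. -/
def wt {d : ℕ} (j : Fin d → ℤ) : ℝ := max (absZ j) 1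

lemma one_le_wt {d : ℕ} (j : Fin d → ℤ) : 1 ≤ wt j := le_max_right _ _
lemma wt_pos {d : ℕ} (j : Fin d → ℤ) : 0 < wt j := zero_lt_one.trans_le (one_le_wt j)

instance (K : ℕ) [NeZero K] : NeZero (2 * K) := ⟨mul_ne_zero two_ne_zero (NeZero.ne K)⟩

/-- The finite group `(ℤ/2K)^d`. -/
abbrev Qd (d K : ℕ) := Fin d → ZMod (2 * K)

/-- Reduction modulo `2K`. -/
def red {d : ℕ} (K : ℕ) (j : Fin d → ℤ) : Qd d K := fun i => ((j i : ℤ) : ZMod (2 * K))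

/-- The representative in `𝒦`. -/
def rep {d K : ℕ} (q : Qd d K) : Fin d → ℤ := fun i => -(ZMod.valMinAbs (-(q i)))

variable {d K : ℕ} [NeZero K]

lemma red_rep (q : Qd d K) : red K (rep q) = q := by
  funext i; simp [red, rep]

lemma red_add (j k : Fin d → ℤ) : red K (j + k) = red K j + red K k := by
  funext i; simp [red]

lemma inK_rep (q : Qd d K) : inK d K (rep q) := by
  intro i
  have h := ZMod.valMinAbs_mem_Ioc (-(q i))
  simp only [rep, Set.mem_Ioc] at *
  push_cast at h
  omega

lemma rep_red {j : Fin d → ℤ} (hj : inK d K j) : rep (red K j) = j := by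
  funext i
  have : ZMod.valMinAbs (-(red K j i)) = -(j i) := by
    rw [ZMod.valMinAbs_spec]
    refine ⟨by simp [red], ?_⟩
    have := hj i
    simp only [Set.mem_Ioc]; push_cast; omega
  simp only [rep, this, neg_neg]

lemma red_eq_iff {j k : Fin d → ℤ} : red K j = red K k ↔ ∃ m : Fin d → ℤ, k = j + (2 * (K : ℤ)) • m := by
  constructor
  · intro h
    have : ∀ i, ∃ m : ℤ, k i = j i + 2 * (K : ℤ) * m := by
      intro i
      have h1 := congrFun h i
      simp only [red] at h1
      rw [ZMod.intCast_eq_intCast_iff_dvd_sub] at h1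
      obtain ⟨m, hm⟩ := h1
      push_cast at hm
      exact ⟨m, by linarith⟩
    choose m hm using this
    exact ⟨m, by funext i; simpa using hm i⟩
  · rintro ⟨m, rfl⟩
    funext i
    simp only [red, Pi.add_apply, Pi.smul_apply, smul_eq_mul]
    have h : ((2 * (K : ℤ) : ℤ) : ZMod (2 * K)) = 0 := by
      have := ZMod.natCast_self (2 * K)
      exact_mod_cast this
    rw [Int.cast_add, Int.cast_mul, h]; simp

lemma abs_rep_red_le (j : Fin d → ℤ) (i : Fin d) : |rep (red K j) i| ≤ |j i| := by
  have h1 : red K (rep (red K j)) = red K j := red_rep _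
  obtain ⟨m, hm⟩ := red_eq_iff.1 h1
  have h2 := inK_rep (red K j) i
  have h3 : j i = rep (red K j) i + 2 * (K : ℤ) * m i := by
    have := congrFun hm i; simpa using this
  set x := rep (red K j) i
  have hK : (0 : ℤ) < K := by exact_mod_cast Nat.pos_of_ne_zero (NeZero.ne K)
  rcases lt_trichotomy (m i) 0 with h | h | h
  · have : 2 * (K : ℤ) * m i ≤ 2 * K * (-1) := by
      apply mul_le_mul_of_nonneg_left <;> omega
    rw [abs_le]; rcases abs_cases (j i) with ⟨a, b⟩ | ⟨a, b⟩ <;> constructor <;> omega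
  · rw [h3, h]; simp
  · have : 2 * (K : ℤ) * m i ≥ 2 * K * 1 := by
      apply mul_le_mul_of_nonneg_left <;> omega
    rw [abs_le]; rcases abs_cases (j i) with ⟨a, b⟩ | ⟨a, b⟩ <;> constructor <;> omega

lemma wt_rep_red_le (j : Fin d → ℤ) : wt (rep (red K j)) ≤ wt j :=
  max_le_max (absZ_mono (abs_rep_red_le j)) le_rfl

lemma wt_rep_add_le (p q : Qd d K) : wt (rep (p + q)) ≤ wt (rep p) + wt (rep q) := by
  have h : p + q = red K (rep p + rep q) := by rw [red_add, red_rep, red_rep]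
  rw [h]
  refine (wt_rep_red_le _).trans ?_
  have h1 := absZ_add_le (rep p) (rep q)
  have h2 : absZ (rep p) ≤ wt (rep p) := le_max_left _ _
  have h3 : absZ (rep q) ≤ wt (rep q) := le_max_left _ _
  have h4 := one_le_wt (rep p)
  have h5 := one_le_wt (rep q)
  exact max_le (by linarith) (by linarith)

/-- One-dimensional sum. -/
def S1 (b : ℝ) : ℝ := ∑' z : ℤ, (max |(z : ℝ)| 1) ^ (-b)

lemma summable_S1 {b : ℝ} (hb : 1 < b) : Summable fun z : ℤ => (max |(z : ℝ)| 1) ^ (-b) := by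
  have h1 := Real.summable_abs_int_rpow hb
  have h2 : Summable fun z : ℤ => if z = 0 then (1 : ℝ) else 0 :=
    summable_of_ne_finset_zero (s := {0}) (by intro b hb; simp at hb; simp [hb])
  refine Summable.of_nonneg_of_le (fun z => by positivity) (fun z => ?_) (h1.add h2)
  by_cases hz : z = 0
  · subst hz; simp; positivity
  · have : (1 : ℝ) ≤ |(z : ℝ)| := by exact_mod_cast Int.one_le_abs hz
    rw [max_eq_left this]; simp [hz]

lemma S1_pos {b : ℝ} (hb : 1 < b) : 0 < S1 b :=
  (summable_S1 hb).tsum_pos (fun z => by positivity) 0 (by simp)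

/-- The weight on the quotient. -/
def Wq (s : ℝ) (q : Qd d K) : ℝ := wt (rep q) ^ s

lemma Wq_pos (s : ℝ) (q : Qd d K) : 0 < Wq s q := Real.rpow_pos_of_pos (wt_pos _) _

lemma Wq_sum_le {s : ℝ} (hd : 1 ≤ d) (hs : (d : ℝ) / 2 < s) :
    ∑ q : Qd d K, ((Wq s q) ^ 2)⁻¹ ≤ S1 (2 * s / d) ^ d := by
  have hd0 : (0 : ℝ) < d := by exact_mod_cast hd
  have hb : 1 < 2 * s / d := by rw [lt_div_iff₀ hd0]; linarith
  have h1 : ∀ q : Qd d K, ((Wq s q) ^ 2)⁻¹ ≤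
      ∏ i, (max |((-(ZMod.valMinAbs (-(q i))) : ℤ) : ℝ)| 1) ^ (-(2 * s / d)) := by
    intro q
    have h2 : ((Wq s q) ^ 2)⁻¹ = ∏ _i : Fin d, (wt (rep q)) ^ (-(2 * s / d)) := by
      rw [Finset.prod_const, Finset.card_univ, Fintype.card_fin,
        ← Real.rpow_natCast (wt (rep q) ^ (-(2 * s / d))) d,
        ← Real.rpow_mul (wt_pos _).le, Wq, ← Real.rpow_natCast, ← Real.rpow_mul (wt_pos _).le,
        ← Real.rpow_neg (wt_pos _).le]
      congr 1; field_simp; push_cast; ring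
    rw [h2]
    refine Finset.prod_le_prod (fun i _ => (Real.rpow_pos_of_pos (wt_pos _) _).le) fun i _ => ?_
    apply Real.rpow_le_rpow_of_nonpos (by positivity)
    · exact max_le_max (abs_le_absZ (rep q) i) le_rfl
    · linarith
  refine (Finset.sum_le_sum fun q _ => h1 q).trans ?_
  have h3 : ∑ q : Qd d K, ∏ i, (max |((-(ZMod.valMinAbs (-(q i))) : ℤ) : ℝ)| 1) ^ (-(2 * s / d))
      = (∑ x : ZMod (2 * K), (max |((-(ZMod.valMinAbs (-x)) : ℤ) : ℝ)| 1) ^ (-(2 * s / d))) ^ d := by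
    have := Finset.prod_univ_sum (fun _ : Fin d => (Finset.univ : Finset (ZMod (2 * K))))
      (fun _ x => (max |((-(ZMod.valMinAbs (-x)) : ℤ) : ℝ)| 1) ^ (-(2 * s / d)))
    rw [Fintype.piFinset_univ] at this
    rw [← this]; simp
  rw [h3]
  have hinj : Function.Injective (fun x : ZMod (2 * K) => -(ZMod.valMinAbs (-x))) := by
    intro x y h
    simpa using ZMod.injective_valMinAbs (neg_injective h)
  gcongr
  rw [← tsum_fintype (L := .unconditional _)]
  exact tsum_comp_le_tsum_of_inj (summable_S1 hb) (fun z => by positivity) hinj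

/-- Square of the algebra constant. -/
def CSq (d : ℕ) (s : ℝ) : ℝ := 2 * 4 ^ s * S1 (2 * s / d) ^ d

lemma Wq_sq_le {s : ℝ} (hs : 0 ≤ s) (p q : Qd d K) :
    Wq s (p + q) ^ 2 ≤ 4 ^ s * (Wq s p ^ 2 + Wq s q ^ 2) := by
  have key : ∀ r : Qd d K, Wq s r ^ 2 = (wt (rep r) ^ 2) ^ s := by
    intro r
    rw [Wq, ← Real.rpow_natCast, ← Real.rpow_mul (wt_pos _).le, mul_comm, Real.rpow_mul (wt_pos _).le]
    simp
  rw [key, key, key]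
  have h := wt_rep_add_le p q
  have h0 := wt_pos (rep (p + q))
  have hp := wt_pos (rep p)
  have hq := wt_pos (rep q)
  have a1 : 0 ≤ (wt (rep p) ^ 2) ^ s := by positivity
  have a2 : 0 ≤ (wt (rep q) ^ 2) ^ s := by positivity
  have a3 : (0 : ℝ) ≤ 4 ^ s := by positivity
  rcases le_total (wt (rep p)) (wt (rep q)) with hl | hl
  · calc (wt (rep (p + q)) ^ 2) ^ s ≤ (4 * wt (rep q) ^ 2) ^ s := by
          apply Real.rpow_le_rpow (by positivity) _ hs; nlinarith
      _ = 4 ^ s * (wt (rep q) ^ 2) ^ s := Real.mul_rpow (by norm_num) (by positivity)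
      _ ≤ _ := by gcongr; linarith
  · calc (wt (rep (p + q)) ^ 2) ^ s ≤ (4 * wt (rep p) ^ 2) ^ s := by
          apply Real.rpow_le_rpow (by positivity) _ hs; nlinarith
      _ = 4 ^ s * (wt (rep p) ^ 2) ^ s := Real.mul_rpow (by norm_num) (by positivity)
      _ ≤ _ := by gcongr; linarith

lemma conv_weight {s : ℝ} (hd : 1 ≤ d) (hs : (d : ℝ) / 2 < s) (F G : Qd d K → ℝ) :
    ∑ q, (Wq s q * ∑ k, F k * G (q - k)) ^ 2 ≤
      CSq d s * ((∑ q, (Wq s q * F q) ^ 2) * ∑ q, (Wq s q * G q) ^ 2) := by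
  have hs0 : 0 ≤ s := by have : (0 : ℝ) ≤ d := by positivity
                         linarith
  have hW : ∀ q : Qd d K, Wq s q ≠ 0 := fun q => (Wq_pos s q).ne'
  have hS := Wq_sum_le (K := K) hd hs
  have h1 : ∀ q : Qd d K, (Wq s q * ∑ k, F k * G (q - k)) ^ 2 ≤
      CSq d s * ∑ k, (Wq s k * F k) ^ 2 * (Wq s (q - k) * G (q - k)) ^ 2 := by
    intro q
    have e1 : Wq s q * ∑ k, F k * G (q - k) = ∑ k, (Wq s q / (Wq s k * Wq s (q - k))) *
        ((Wq s k * F k) * (Wq s (q - k) * G (q - k))) := by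
      rw [Finset.mul_sum]
      refine Finset.sum_congr rfl fun k _ => ?_
      have := hW k; have := hW (q - k)
      field_simp
    rw [e1]
    refine (Finset.sum_mul_sq_le_sq_mul_sq _ _ _).trans ?_
    have e2 : ∑ k, (Wq s q / (Wq s k * Wq s (q - k))) ^ 2 ≤ CSq d s := by
      have e3 : ∀ k, (Wq s q / (Wq s k * Wq s (q - k))) ^ 2 ≤
          4 ^ s * ((Wq s k ^ 2)⁻¹ + (Wq s (q - k) ^ 2)⁻¹) := by
        intro k
        have h := Wq_sq_le hs0 k (q - k)
        rw [add_sub_cancel] at h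
        have p1 := Wq_pos s k; have p2 := Wq_pos s (q - k)
        rw [div_pow, div_le_iff₀ (by positivity)]
        refine h.trans (le_of_eq ?_)
        field_simp
        ring
      refine (Finset.sum_le_sum fun k _ => e3 k).trans ?_
      rw [← Finset.mul_sum, Finset.sum_add_distrib,
        Fintype.sum_equiv (Equiv.subLeft q) (fun k => (Wq s (q - k) ^ 2)⁻¹)
          (fun k => (Wq s k ^ 2)⁻¹) (fun k => rfl), CSq]
      have : (0 : ℝ) < 4 ^ s := by positivity
      nlinarith
    simp only [mul_pow] at *
    exact mul_le_mul_of_nonneg_right e2 (Finset.sum_nonneg fun k _ => by positivity)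
  refine (Finset.sum_le_sum fun q _ => h1 q).trans (le_of_eq ?_)
  rw [← Finset.mul_sum, Finset.sum_comm, Finset.sum_mul]
  congr 1
  refine Finset.sum_congr rfl fun k _ => ?_
  rw [← Finset.mul_sum]
  congr 1
  exact Fintype.sum_equiv (Equiv.subRight k) _ (fun q => (Wq s q * G q) ^ 2) (fun q => rfl)

lemma CSq_pos {s : ℝ} (hd : 1 ≤ d) (hs : (d : ℝ) / 2 < s) : 0 < CSq d s := by
  have hd0 : (0 : ℝ) < d := by exact_mod_cast hd
  have hb : 1 < 2 * s / d := by rw [lt_div_iff₀ hd0]; linarith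
  have := S1_pos hb
  unfold CSq; positivity



/-! ### The cyclic convolution algebra with a Sobolev norm -/

/-- Cyclic convolution algebra. -/
def Cyc (d K : ℕ) (_s : ℝ) := AddMonoidAlgebra ℂ (Qd d K)

section cyc
variable {d K : ℕ} {s : ℝ}

instance : CommRing (Cyc d K s) := inferInstanceAs (CommRing (AddMonoidAlgebra ℂ (Qd d K)))
instance : Algebra ℂ (Cyc d K s) := inferInstanceAs (Algebra ℂ (AddMonoidAlgebra ℂ (Qd d K)))

/-- Coefficients. -/
def Cyc.cf (x : Cyc d K s) (q : Qd d K) : ℂ := AddMonoidAlgebra.coeff x q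

lemma Cyc.cf_add (x y : Cyc d K s) (q : Qd d K) : (x + y).cf q = x.cf q + y.cf q := rfl
lemma Cyc.cf_smul (z : ℂ) (x : Cyc d K s) (q : Qd d K) : (z • x).cf q = z * x.cf q := rfl
lemma Cyc.cf_zero (q : Qd d K) : (0 : Cyc d K s).cf q = 0 := rfl
lemma Cyc.cf_neg (x : Cyc d K s) (q : Qd d K) : (-x).cf q = -x.cf q := by
  rw [← neg_one_smul ℂ x, Cyc.cf_smul]; ring
lemma Cyc.cf_sub (x y : Cyc d K s) (q : Qd d K) : (x - y).cf q = x.cf q - y.cf q := by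
  rw [sub_eq_add_neg, Cyc.cf_add, Cyc.cf_neg, sub_eq_add_neg]
lemma Cyc.ext' {x y : Cyc d K s} (h : ∀ q, x.cf q = y.cf q) : x = y :=
  AddMonoidAlgebra.ext (Finsupp.ext h)

/-- Coefficient as a linear functional. -/
def Cyc.cfL (q : Qd d K) : Cyc d K s →ₗ[ℂ] ℂ where
  toFun x := x.cf q
  map_add' _ _ := rfl
  map_smul' _ _ := rfl

/-- The basis character. -/
def Cyc.e (j : Fin d → ℤ) : Cyc d K s := AddMonoidAlgebra.single (red K j) (1 : ℂ)

lemma Cyc.cf_e (j : Fin d → ℤ) (q : Qd d K) :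
    (Cyc.e j : Cyc d K s).cf q = if red K j = q then 1 else 0 :=
  AddMonoidAlgebra.coeff_single_apply

variable [NeZero K]

lemma Cyc.cf_mul (x y : Cyc d K s) (q : Qd d K) : (x * y).cf q = ∑ k, x.cf k * y.cf (q - k) := by
  have h := AddMonoidAlgebra.coeff_mul (R := ℂ) (M := Qd d K) x y q
  rw [Finsupp.sum_fintype _ _ (by intro i; simp)] at h
  refine Eq.trans h (Finset.sum_congr rfl fun k _ => ?_)
  rw [Finsupp.sum_fintype _ _ (by intro i; simp), Finset.sum_eq_single (q - k)]
  · simp [Cyc.cf]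
  · intro b _ hb
    rw [if_neg]; intro h; exact hb (by rw [← h]; simp)
  · simp

instance : Module.Finite ℂ (Cyc d K s) :=
  Module.Finite.equiv ((AddMonoidAlgebra.coeffLinearEquiv (M := Qd d K) (S := ℂ) ℂ).trans
    (Finsupp.linearEquivFunOnFinite ℂ ℂ (Qd d K))).symm

/-- Weighted `ℓ²` norm. -/
def nq (s : ℝ) (f : Qd d K → ℂ) : ℝ := Real.sqrt (∑ q, (Wq s q * ‖f q‖) ^ 2)

lemma nq_eq (s : ℝ) (f : Qd d K → ℂ) :
    nq s f = ‖(WithLp.toLp 2 (fun q => (Wq s q : ℂ) * f q) : EuclideanSpace ℂ (Qd d K))‖ := by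
  rw [EuclideanSpace.norm_eq, nq]
  congr 1
  refine Finset.sum_congr rfl fun q _ => ?_
  simp [abs_of_pos (Wq_pos s q)]

lemma nq_add_le (s : ℝ) (f g : Qd d K → ℂ) : nq s (f + g) ≤ nq s f + nq s g := by
  rw [nq_eq, nq_eq, nq_eq]
  refine le_trans (le_of_eq ?_) (norm_add_le _ _)
  congr 1
  ext q; simp [mul_add]

lemma nq_nonneg (s : ℝ) (f : Qd d K → ℂ) : 0 ≤ nq s f := Real.sqrt_nonneg _

lemma nq_smul (s : ℝ) (z : ℂ) (f : Qd d K → ℂ) : nq s (fun q => z * f q) = ‖z‖ * nq s f := by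
  rw [nq_eq, nq_eq, ← norm_smul]
  congr 1
  ext q; simp; ring

lemma nq_eq_zero {s : ℝ} {f : Qd d K → ℂ} (h : nq s f = 0) (q : Qd d K) : f q = 0 := by
  rw [nq_eq, norm_eq_zero] at h
  have := congrArg (fun x : EuclideanSpace ℂ (Qd d K) => x q) h
  simpa [(Wq_pos s q).ne'] using this

lemma nq_conv {s : ℝ} (hd : 1 ≤ d) (hs : (d : ℝ) / 2 < s) (f g : Qd d K → ℂ) :
    nq s (fun q => ∑ k, f k * g (q - k)) ≤ Real.sqrt (CSq d s) * (nq s f * nq s g) := by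
  rw [nq, nq, nq, ← Real.sqrt_mul (Finset.sum_nonneg fun _ _ => sq_nonneg _),
    ← Real.sqrt_mul (CSq_pos hd hs).le]
  apply Real.sqrt_le_sqrt
  refine le_trans ?_ (conv_weight hd hs (fun q => ‖f q‖) (fun q => ‖g q‖))
  refine Finset.sum_le_sum fun q _ => ?_
  have := Wq_pos s q
  gcongr
  refine (norm_sum_le _ _).trans (le_of_eq ?_)
  simp

variable [hd : Fact (1 ≤ d)] [hs : Fact ((d : ℝ) / 2 < s)]

/-- The ring norm. -/
def Cyc.rn : RingNorm (Cyc d K s) where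
  toFun x := Real.sqrt (CSq d s) * nq s x.cf
  map_zero' := by
    have : nq (d := d) (K := K) s (0 : Cyc d K s).cf = 0 := by
      simp [nq, Cyc.cf_zero]
    rw [this, mul_zero]
  add_le' x y := by
    rw [← mul_add]
    exact mul_le_mul_of_nonneg_left (nq_add_le s x.cf y.cf) (Real.sqrt_nonneg _)
  neg' x := by
    have : nq s (-x).cf = nq s x.cf := by simp [nq, Cyc.cf_neg]
    rw [this]
  mul_le' x y := by
    have h : (x * y).cf = fun q => ∑ k, x.cf k * y.cf (q - k) := funext (Cyc.cf_mul x y)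
    rw [h]
    calc _ ≤ Real.sqrt (CSq d s) * (Real.sqrt (CSq d s) * (nq s x.cf * nq s y.cf)) :=
          mul_le_mul_of_nonneg_left (nq_conv hd.out hs.out _ _) (Real.sqrt_nonneg _)
      _ = _ := by ring
  eq_zero_of_map_eq_zero' x h := by
    have := Real.sqrt_pos.2 (CSq_pos hd.out hs.out)
    have h2 := (mul_eq_zero.1 h).resolve_left this.ne'
    exact Cyc.ext' fun q => (nq_eq_zero h2 q).trans (Cyc.cf_zero q).symm

instance : NormedCommRing (Cyc d K s) :=
  { RingNorm.toNormedRing (Cyc.rn (d := d) (K := K) (s := s)) with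
    mul_comm := mul_comm }

lemma Cyc.norm_def (x : Cyc d K s) : ‖x‖ = Real.sqrt (CSq d s) * nq s x.cf := rfl

instance : NormedAlgebra ℂ (Cyc d K s) where
  norm_smul_le z x := by
    rw [Cyc.norm_def, Cyc.norm_def]
    have : (z • x).cf = fun q => z * x.cf q := rfl
    rw [this, nq_smul]
    exact le_of_eq (by ring)

instance : CompleteSpace (Cyc d K s) := FiniteDimensional.complete ℂ _

lemma Cyc.isChar : IsChar (Cyc.e : (Fin d → ℤ) → Cyc d K s) where
  zero := by
    have : red K (0 : Fin d → ℤ) = (0 : Qd d K) := by funext i; simp [red]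
    rw [Cyc.e, this]; rfl
  add j k := by
    rw [Cyc.e, red_add]
    have := AddMonoidAlgebra.single_mul_single (R := ℂ) (red K j) (red K k) (1 : ℂ) 1
    rw [one_mul] at this
    exact this.symm
  bdd := by
    refine ⟨∑ q : Qd d K, ‖(Cyc.e (rep q) : Cyc d K s)‖, fun j => ?_⟩
    have h : (Cyc.e j : Cyc d K s) = Cyc.e (rep (red K j)) := by
      rw [Cyc.e, Cyc.e, red_rep]
    rw [h]
    exact Finset.single_le_sum (f := fun q : Qd d K => ‖(Cyc.e (rep q) : Cyc d K s)‖)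
      (fun q _ => norm_nonneg _) (Finset.mem_univ (red K j))

/-- The projection of absolutely summable coefficients to the cyclic algebra. -/
def Cyc.P (d K : ℕ) (s : ℝ) [NeZero K] [Fact (1 ≤ d)] [Fact ((d : ℝ) / 2 < s)] (v : Coef d) :
    Cyc d K s := PP Cyc.e v

lemma Cyc.cf_P {v : Coef d} (hv : Ss v) (q : Qd d K) :
    (Cyc.P d K s v).cf q = interp d K v (rep q) := by
  have h1 := (LinearMap.toContinuousLinearMap (Cyc.cfL (s := s) q)).map_tsum
    ((Cyc.isChar (d := d) (K := K) (s := s)).summable hv)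
  have h2 : (Cyc.P d K s v).cf q = ∑' j, v j * (if red K j = q then 1 else 0) := by
    refine Eq.trans h1 (tsum_congr fun j => ?_)
    change (v j • Cyc.e j : Cyc d K s).cf q = _
    rw [Cyc.cf_smul, Cyc.cf_e]
  rw [h2, interp, if_pos (inK_rep q)]
  have hinj : Function.Injective (fun m : Fin d → ℤ => rep q + (2 * (K : ℤ)) • m) := by
    intro m m' h
    have hK : (2 * (K : ℤ)) ≠ 0 := by
      have := NeZero.ne K
      positivity
    exact smul_right_injective _ hK (add_left_cancel h)
  rw [← hinj.tsum_eq]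
  · refine tsum_congr fun m => ?_
    rw [if_pos, mul_one]
    rw [← red_eq_iff.2 ⟨m, rfl⟩, red_rep]
  · intro j hj
    have : red K j = q := by
      by_contra hne; simp [hne] at hj
    obtain ⟨m, hm⟩ := red_eq_iff.1 ((red_rep q).trans this.symm)
    exact ⟨m, hm.symm⟩

end cyc

lemma isTrig_interp (d K : ℕ) (v : Coef d) : isTrig d K (interp d K v) := by
  intro j hj; simp [interp, hj]

section bridge
variable {d K : ℕ} [NeZero K]

lemma rep_injective : Function.Injective (rep : Qd d K → Fin d → ℤ) := by
  intro p q h; rw [← red_rep p, h, red_rep]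

lemma sob_eq {v : Coef d} (hv : isTrig d K v) (r : ℝ) :
    sobNorm r v = nq r (fun q : Qd d K => v (rep q)) := by
  rw [sobNorm, nq, ← (rep_injective (d := d) (K := K)).tsum_eq, tsum_fintype]
  · congr 1
    refine Finset.sum_congr rfl fun q _ => ?_
    rw [mul_pow, Wq, ← Real.rpow_natCast (wt (rep q) ^ r), ← Real.rpow_mul (wt_pos _).le, mul_comm r]
    rfl
  · intro j hj
    by_contra hne
    have : ¬ inK d K j := fun h => hne ⟨red K j, rep_red h⟩
    simp [hv j this] at hj

lemma isTrig.ss {v : Coef d} (hv : isTrig d K v) : Ss v := by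
  refine summable_of_ne_finset_zero (s := Finset.univ.image (rep : Qd d K → Fin d → ℤ)) ?_
  intro j hj
  have : ¬ inK d K j := fun h => hj (Finset.mem_image.2 ⟨red K j, Finset.mem_univ _, rep_red h⟩)
  simp [hv j this]

lemma interp_trig {v : Coef d} (hv : isTrig d K v) : interp d K v = v := by
  funext j
  by_cases hj : inK d K j
  · rw [interp, if_pos hj, tsum_eq_single 0]
    · simp
    · intro m hm
      apply hv
      intro hin
      have h1 : red K j = red K (j + (2 * (K : ℤ)) • m) := red_eq_iff.2 ⟨m, rfl⟩
      have h2 := congrArg rep h1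
      rw [rep_red hj, rep_red hin] at h2
      have hK : (2 * (K : ℤ)) ≠ 0 := by
        have := NeZero.ne K
        positivity
      have h3 : (2 * (K : ℤ)) • m = 0 := by simpa using h2.symm
      exact hm ((smul_eq_zero.1 h3).resolve_left hK)
  · rw [hv j hj, interp, if_neg hj]

variable {s : ℝ} [hd : Fact (1 ≤ d)] [hs : Fact ((d : ℝ) / 2 < s)]

lemma Cyc.norm_P {v : Coef d} (hv : Ss v) :
    ‖Cyc.P d K s v‖ = Real.sqrt (CSq d s) * sobNorm s (interp d K v) := by
  rw [Cyc.norm_def, sob_eq (isTrig_interp d K v)]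
  congr 2
  funext q
  exact Cyc.cf_P hv q

lemma interp_eq_of_P {v w : Coef d} (hv : Ss v) (hw : Ss w)
    (h : Cyc.P d K s v = Cyc.P d K s w) : interp d K v = interp d K w := by
  funext j
  by_cases hj : inK d K j
  · have h1 := Cyc.cf_P (K := K) (s := s) hv (red K j)
    have h2 := Cyc.cf_P (K := K) (s := s) hw (red K j)
    rw [rep_red hj] at h1 h2
    rw [← h1, ← h2, h]
  · rw [interp, interp, if_neg hj, if_neg hj]

lemma P_interp {v : Coef d} (hv : Ss v) : Cyc.P d K s (interp d K v) = Cyc.P d K s v := by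
  apply Cyc.ext'
  intro q
  rw [Cyc.cf_P hv, Cyc.cf_P (isTrig_interp d K v).ss, interp_trig (isTrig_interp d K v)]

lemma interp_sub {v w : Coef d} (hv : Ss v) (hw : Ss w) :
    interp d K (v - w) = interp d K v - interp d K w := by
  have ht : isTrig d K (interp d K v - interp d K w) := by
    intro j hj; simp [isTrig_interp d K v j hj, isTrig_interp d K w j hj]
  haveI : Fact ((d : ℝ) / 2 < (d : ℝ)) := ⟨by
    have : (0 : ℝ) < d := by exact_mod_cast hd.out
    linarith⟩
  rw [← interp_trig ht]
  refine interp_eq_of_P (s := d) (hv.sub hw) ht.ss ?_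
  have hc := Cyc.isChar (d := d) (K := K) (s := d)
  have e1 : Cyc.P d K d (v - w) = Cyc.P d K d v - Cyc.P d K d w := hc.map_sub hv hw
  have e2 : Cyc.P d K d (interp d K v - interp d K w)
      = Cyc.P d K d (interp d K v) - Cyc.P d K d (interp d K w) :=
    hc.map_sub (isTrig_interp d K v).ss (isTrig_interp d K w).ss
  rw [e1, e2, P_interp hv, P_interp hw]

end bridge


/-! ### Product, modulus-square and exponential estimates -/

section basics
variable {d K : ℕ}

lemma isTrig.sub {v w : Coef d} (hv : isTrig d K v) (hw : isTrig d K w) : isTrig d K (v - w) := by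
  intro j hj; simp [hv j hj, hw j hj]
lemma isTrig.add {v w : Coef d} (hv : isTrig d K v) (hw : isTrig d K w) : isTrig d K (v + w) := by
  intro j hj; simp [hv j hj, hw j hj]
lemma isTrig.smul (z : ℂ) {v : Coef d} (hv : isTrig d K v) : isTrig d K (z • v) := by
  intro j hj; simp [hv j hj]
lemma isTrig.mulOp (g : ℝ → ℂ) {v : Coef d} (hv : isTrig d K v) : isTrig d K (mulOp g v) := by
  intro j hj; simp [Zak.mulOp, hv j hj]

lemma isTrig.neg {v : Coef d} (hv : isTrig d K v) : isTrig d K (-v) := by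
  intro j hj; simp [hv j hj]

lemma Ss.conjC {v : Coef d} (hv : Ss v) : Ss (conjC v) := by
  have h := (Equiv.neg (Fin d → ℤ)).summable_iff.2 hv
  refine h.congr fun j => ?_
  simp [Zak.conjC]

lemma conjC_sub (v w : Coef d) : conjC (v - w) = conjC v - conjC w := by
  funext j; simp [conjC]

/-- The nonlinearity `v ϕ(iτv) x`. -/
def Jn (τ : ℝ) (v x : Coef d) : Coef d :=
  conv v (conv (phiC ((Complex.I * (τ : ℂ)) • v)) x)

lemma Ss.Jn {τ : ℝ} {v x : Coef d} (hv : Ss v) (hx : Ss x) : Ss (Jn τ v x) :=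
  hv.conv (((hv.smul _).phiC).conv hx)

end basics

section plevel
variable {d K : ℕ} [NeZero K] {s : ℝ} [hd : Fact (1 ≤ d)] [hs : Fact ((d : ℝ) / 2 < s)]

lemma P_add {v w : Coef d} (hv : Ss v) (hw : Ss w) :
    Cyc.P d K s (v + w) = Cyc.P d K s v + Cyc.P d K s w := Cyc.isChar.map_add hv hw
lemma P_sub {v w : Coef d} (hv : Ss v) (hw : Ss w) :
    Cyc.P d K s (v - w) = Cyc.P d K s v - Cyc.P d K s w := Cyc.isChar.map_sub hv hw
lemma P_smul (z : ℂ) {v : Coef d} (hv : Ss v) :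
    Cyc.P d K s (z • v) = z • Cyc.P d K s v := Cyc.isChar.map_smul z hv
lemma P_conv {v w : Coef d} (hv : Ss v) (hw : Ss w) :
    Cyc.P d K s (conv v w) = Cyc.P d K s v * Cyc.P d K s w := Cyc.isChar.map_conv hv hw
lemma P_expC {v : Coef d} (hv : Ss v) :
    Cyc.P d K s (expC v) = NormedSpace.exp (Cyc.P d K s v) := Cyc.isChar.map_expC hv

lemma norm_P_trig {v : Coef d} (hv : isTrig d K v) :
    ‖Cyc.P d K s v‖ = Real.sqrt (CSq d s) * sobNorm s v := by
  rw [Cyc.norm_P hv.ss, interp_trig hv]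

lemma Cyc.cf_P' {v : Coef d} (hv : Ss v) (q : Qd d K) :
    (Cyc.P d K s v).cf q = ∑' j, v j * (if red K j = q then 1 else 0) := by
  have h1 := (LinearMap.toContinuousLinearMap (Cyc.cfL (s := s) q)).map_tsum
    ((Cyc.isChar (d := d) (K := K) (s := s)).summable hv)
  refine Eq.trans h1 (tsum_congr fun j => ?_)
  change (v j • Cyc.e j : Cyc d K s).cf q = _
  rw [Cyc.cf_smul, Cyc.cf_e]

lemma cf_P_conj {v : Coef d} (hv : Ss v) (q : Qd d K) :
    (Cyc.P d K s (conjC v)).cf q = (starRingEnd ℂ) ((Cyc.P d K s v).cf (-q)) := by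
  rw [Cyc.cf_P' hv.conjC, Cyc.cf_P' hv, Complex.conj_tsum, ← (Equiv.neg (Fin d → ℤ)).tsum_eq]
  refine tsum_congr fun j => ?_
  have : red K (-j) = q ↔ red K j = -q := by
    have : red K (-j) = -red K j := by funext i; simp [red]
    rw [this, neg_eq_iff_eq_neg]
  by_cases h : red K j = -q
  · simp [conjC, h, this.2 h]
  · simp [conjC, h, mt this.1 h]

lemma Wq_neg (r : ℝ) (q : Qd d K) : Wq r (-q) = Wq r q := by
  have key : ∀ q : Qd d K, wt (rep (-q)) ≤ wt (rep q) := by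
    intro q
    have h := wt_rep_red_le (K := K) (-(rep q))
    have e1 : red K (-(rep q)) = -q := by
      have : red K (-(rep q)) = -red K (rep q) := by funext i; simp [red]
      rw [this, red_rep]
    have e2 : wt (-(rep q)) = wt (rep q) := by simp [wt, absZ_neg]
    rwa [e1, e2] at h
  have h2 := key (-q)
  rw [neg_neg] at h2
  rw [Wq, Wq, le_antisymm (key q) h2]

lemma norm_P_conj {v : Coef d} (hv : Ss v) : ‖Cyc.P d K s (conjC v)‖ = ‖Cyc.P d K s v‖ := by
  rw [Cyc.norm_def, Cyc.norm_def]
  congr 1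
  rw [nq, nq]
  congr 1
  refine Fintype.sum_equiv (Equiv.neg (Qd d K)) _ _ fun q => ?_
  rw [cf_P_conj hv]
  simp [Wq_neg]

lemma sqrtC_pos : 0 < Real.sqrt (CSq d s) := Real.sqrt_pos.2 (CSq_pos hd.out hs.out)

lemma norm_P_interp_sub {a b : Coef d} (ha : Ss a) (hb : Ss b) :
    ‖Cyc.P d K s a - Cyc.P d K s b‖
      = Real.sqrt (CSq d s) * sobNorm s (interp d K a - interp d K b) := by
  rw [← norm_P_trig ((isTrig_interp d K a).sub (isTrig_interp d K b)),
    P_sub (isTrig_interp d K a).ss (isTrig_interp d K b).ss, P_interp ha, P_interp hb]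

lemma absSq_lip {p p' : Coef d} (hp : isTrig d K p) (hp' : isTrig d K p') :
    sobNorm s (interp d K (absSq p) - interp d K (absSq p'))
      ≤ Real.sqrt (CSq d s) * ((sobNorm s p + sobNorm s p') * sobNorm s (p - p')) := by
  have h0 := sqrtC_pos (d := d) (s := s)
  refine le_of_mul_le_mul_left ?_ h0
  rw [absSq, absSq, ← norm_P_interp_sub (hp.ss.conv hp.ss.conjC) (hp'.ss.conv hp'.ss.conjC),
    P_conv hp.ss hp.ss.conjC, P_conv hp'.ss hp'.ss.conjC]
  have e : Cyc.P d K s p * Cyc.P d K s (conjC p) - Cyc.P d K s p' * Cyc.P d K s (conjC p')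
      = Cyc.P d K s (p - p') * Cyc.P d K s (conjC p)
        + Cyc.P d K s p' * Cyc.P d K s (conjC (p - p')) := by
    rw [conjC_sub, P_sub hp.ss hp'.ss, P_sub hp.ss.conjC hp'.ss.conjC]; ring
  rw [e]
  refine (norm_add_le _ _).trans ((add_le_add (norm_mul_le _ _) (norm_mul_le _ _)).trans ?_)
  rw [norm_P_conj hp.ss, norm_P_conj (hp.sub hp').ss, norm_P_trig hp, norm_P_trig hp',
    norm_P_trig (hp.sub hp')]
  exact le_of_eq (by ring)

lemma P_Jn {τ : ℝ} {v x : Coef d} (hv : Ss v) (hx : Ss x) :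
    (Complex.I * (τ : ℂ)) • Cyc.P d K s (Jn τ v x)
      = (NormedSpace.exp ((Complex.I * (τ : ℂ)) • Cyc.P d K s v) - 1) * Cyc.P d K s x := by
  have h := (Cyc.isChar (d := d) (K := K) (s := s)).map_phiC (hv.smul (Complex.I * (τ : ℂ)))
  change Cyc.P d K s _ * Cyc.P d K s _ = NormedSpace.exp (Cyc.P d K s _) - 1 at h
  rw [P_smul _ hv] at h
  rw [← h, Jn, P_conv hv (((hv.smul _).phiC).conv hx), P_conv ((hv.smul _).phiC) hx,
    smul_mul_assoc, smul_mul_assoc, mul_assoc]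

lemma Jn_lip {τ D : ℝ} (hτ : 0 < τ) {v v' x x' : Coef d} (hv : isTrig d K v)
    (hv' : isTrig d K v') (hx : isTrig d K x) (hx' : isTrig d K x')
    (hD : τ * (Real.sqrt (CSq d s) * sobNorm s v) ≤ D)
    (hD' : τ * (Real.sqrt (CSq d s) * sobNorm s v') ≤ D) :
    sobNorm s (interp d K (Jn τ v x) - interp d K (Jn τ v' x'))
      ≤ Real.sqrt (CSq d s) * ((1 + D * Real.exp D) * Real.exp (2 * D)
          * sobNorm s (v - v') * sobNorm s x
        + sobNorm s v' * Real.exp D * sobNorm s (x - x')) := by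
  have h0 := sqrtC_pos (d := d) (s := s)
  have hz : ‖Complex.I * (τ : ℂ)‖ = τ := by simp [abs_of_pos hτ]
  have h := exp_lip (Complex.I * (τ : ℂ)) (Cyc.P d K s v) (Cyc.P d K s v') (Cyc.P d K s x)
    (Cyc.P d K s x') D (by rw [hz, norm_P_trig hv]; exact hD)
    (by rw [hz, norm_P_trig hv']; exact hD')
  rw [← P_Jn hv.ss hx.ss, ← P_Jn hv'.ss hx'.ss, ← smul_sub, norm_smul, hz,
    norm_P_interp_sub (hv.ss.Jn hx.ss) (hv'.ss.Jn hx'.ss), ← P_sub hv.ss hv'.ss,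
    ← P_sub hx.ss hx'.ss, norm_P_trig (hv.sub hv'), norm_P_trig hx, norm_P_trig hv',
    norm_P_trig (hx.sub hx')] at h
  have h2 := le_of_mul_le_mul_left h hτ
  refine le_of_mul_le_mul_left (h2.trans (le_of_eq ?_)) h0
  ring

end plevel

/-! ### Mode-wise estimates -/
section modes
variable {d K : ℕ} [NeZero K]

lemma sob_nonneg (r : ℝ) (v : Coef d) : 0 ≤ sobNorm r v := Real.sqrt_nonneg _

lemma sob_zero (r : ℝ) : sobNorm r (0 : Coef d) = 0 := by simp [sobNorm]

lemma sob_add_le {v w : Coef d} (hv : isTrig d K v) (hw : isTrig d K w) (r : ℝ) :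
    sobNorm r (v + w) ≤ sobNorm r v + sobNorm r w := by
  rw [sob_eq (hv.add hw), sob_eq hv, sob_eq hw]
  exact nq_add_le r _ _

lemma sob_neg (r : ℝ) (v : Coef d) : sobNorm r (-v) = sobNorm r v := by simp [sobNorm]

lemma sob_sub_le {v w : Coef d} (hv : isTrig d K v) (hw : isTrig d K w) (r : ℝ) :
    sobNorm r (v - w) ≤ sobNorm r v + sobNorm r w := by
  rw [sub_eq_add_neg, ← sob_neg r w]
  exact sob_add_le hv hw.neg r

/-- Weighted mode-wise comparison. -/
lemma sob_le_of {v w : Coef d} (hv : isTrig d K v) (hw : isTrig d K w) {r r' c : ℝ} (hc : 0 ≤ c)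
    (h : ∀ j, inK d K j → wt j ^ r * ‖v j‖ ≤ c * (wt j ^ r' * ‖w j‖)) :
    sobNorm r v ≤ c * sobNorm r' w := by
  rw [sob_eq hv, sob_eq hw, nq, nq, ← Real.sqrt_sq hc, ← Real.sqrt_mul (sq_nonneg c)]
  apply Real.sqrt_le_sqrt
  rw [Finset.mul_sum]
  refine Finset.sum_le_sum fun q _ => ?_
  rw [← mul_pow]
  have := Wq_pos r q
  have := h (rep q) (inK_rep q)
  exact pow_le_pow_left₀ (by positivity) this 2

lemma sob_mono {v : Coef d} (hv : isTrig d K v) {r r' : ℝ} (h : r ≤ r') :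
    sobNorm r v ≤ sobNorm r' v := by
  have := sob_le_of hv hv (r := r) (r' := r') (c := 1) zero_le_one (fun j _ => by
    rw [one_mul]
    gcongr
    exact one_le_wt j)
  rwa [one_mul] at this

lemma sob_mul_le {v w : Coef d} (hv : isTrig d K v) (hw : isTrig d K w) {r c : ℝ} (hc : 0 ≤ c)
    (h : ∀ j, ‖v j‖ ≤ c * ‖w j‖) : sobNorm r v ≤ c * sobNorm r w :=
  sob_le_of hv hw hc fun j _ => by
    have : 0 ≤ wt j ^ r := Real.rpow_nonneg (wt_pos j).le _
    calc _ ≤ wt j ^ r * (c * ‖w j‖) := mul_le_mul_of_nonneg_left (h j) this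
      _ = _ := by ring

lemma sob_smul_le {v : Coef d} (hv : isTrig d K v) (r : ℝ) (z : ℂ) :
    sobNorm r (z • v) ≤ ‖z‖ * sobNorm r v :=
  sob_mul_le (hv.smul z) hv (norm_nonneg z) fun j => by simp

lemma sob_mulOp_le {v : Coef d} (hv : isTrig d K v) (r : ℝ) {g : ℝ → ℂ} {c : ℝ} (hc : 0 ≤ c)
    (hg : ∀ x, ‖g x‖ ≤ c) : sobNorm r (mulOp g v) ≤ c * sobNorm r v :=
  sob_mul_le (hv.mulOp g) hv hc fun j => by
    rw [mulOp, norm_mul]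
    exact mul_le_mul_of_nonneg_right (hg _) (norm_nonneg _)

lemma sob_sum_le {ι : Type*} (S : Finset ι) {f : ι → Coef d} (hf : ∀ i ∈ S, isTrig d K (f i)) (r : ℝ) :
    isTrig d K (∑ i ∈ S, f i) ∧ sobNorm r (∑ i ∈ S, f i) ≤ ∑ i ∈ S, sobNorm r (f i) := by
  classical
  induction S using Finset.induction_on with
  | empty => exact ⟨by intro j _; simp, by simp [sob_zero]⟩
  | insert a S ha ih =>
    obtain ⟨h1, h2⟩ := ih fun i hi => hf i (Finset.mem_insert_of_mem hi)
    have h3 := hf a (Finset.mem_insert_self a S)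
    rw [Finset.sum_insert ha, Finset.sum_insert ha]
    exact ⟨h3.add h1, (sob_add_le h3 h1 r).trans (by linarith)⟩

lemma abs_sinc_le (x : ℝ) : |sinc x| ≤ 1 := by
  rw [sinc]
  split_ifs with h
  · simp
  · rw [abs_div, div_le_one (abs_pos.2 h)]
    exact Real.abs_sin_le_abs

lemma x_sinc (x : ℝ) : x * sinc x = Real.sin x := by
  rw [sinc]; split_ifs with h
  · simp [h]
  · field_simp

lemma mulOp_sub (g : ℝ → ℂ) (v w : Coef d) : mulOp g v - mulOp g w = mulOp g (v - w) := by
  funext j; simp [mulOp]; ring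

lemma pair_le (r : ℝ) (v w : Coef d) : sobNorm (r + 1) v ≤ pairNorm r v w ∧ sobNorm r w ≤ pairNorm r v w := by
  constructor
  · exact Real.le_sqrt_of_sq_le (by nlinarith [sq_nonneg (sobNorm r w)])
  · exact Real.le_sqrt_of_sq_le (by nlinarith [sq_nonneg (sobNorm (r + 1) v)])

end modes


/-! ### The operator `poissonInv` under the CFL condition -/

lemma cos_half_aux (y : ℝ) : Real.cos y = 1 - 2 * Real.sin (y / 2) ^ 2 := by
  have h := Real.cos_two_mul (y / 2)
  have h2 := Real.sin_sq_add_cos_sq (y / 2)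
  rw [mul_div_cancel₀ y two_ne_zero] at h
  linarith

lemma den_lower_aux {c : ℝ} (hc : c < 2 * Real.pi) :
    ∃ κ : ℝ, 0 < κ ∧ ∀ θ τ : ℝ, 0 ≤ θ → θ ≤ c → 0 < τ →
      κ * θ ≤ ‖Complex.exp (Complex.I * (θ : ℂ)) - 1 + Complex.I * (τ : ℂ)‖ := by
  have hpi := Real.pi_pos
  set m : ℝ := min (1 / 2) ((2 * Real.pi - c) / Real.pi) with hm
  have hm0 : 0 < m := lt_min (by norm_num) (div_pos (by linarith) hpi)
  refine ⟨min (2 / Real.pi) (m ^ 2 / Real.pi), by positivity, ?_⟩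
  intro θ τ h0 hθ hτ
  have hre : (Complex.exp (Complex.I * (θ : ℂ)) - 1 + Complex.I * (τ : ℂ)).re = Real.cos θ - 1 := by
    rw [mul_comm Complex.I (θ : ℂ)]
    simp [Complex.exp_ofReal_mul_I_re]
  have him : (Complex.exp (Complex.I * (θ : ℂ)) - 1 + Complex.I * (τ : ℂ)).im = Real.sin θ + τ := by
    rw [mul_comm Complex.I (θ : ℂ)]
    simp [Complex.exp_ofReal_mul_I_im]
  by_cases h1 : θ ≤ Real.pi / 2
  · have h2 := Real.mul_le_sin h0 h1
    refine le_trans ?_ (Complex.abs_im_le_norm _)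
    rw [him]
    refine le_trans ?_ (le_abs_self _)
    have : min (2 / Real.pi) (m ^ 2 / Real.pi) * θ ≤ 2 / Real.pi * θ :=
      mul_le_mul_of_nonneg_right (min_le_left _ _) h0
    linarith
  · push Not at h1
    refine le_trans ?_ (Complex.abs_re_le_norm _)
    rw [hre, abs_sub_comm]
    refine le_trans ?_ (le_abs_self _)
    have hcos : 1 - Real.cos θ = 2 * Real.sin (θ / 2) ^ 2 := by
      have := cos_half_aux θ
      linarith
    have hsin : m ≤ Real.sin (θ / 2) := by
      by_cases h3 : θ / 2 ≤ Real.pi / 2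
      · refine (min_le_left _ _).trans (le_trans ?_ (Real.mul_le_sin (by linarith) h3))
        rw [div_mul_div_comm, div_le_div_iff₀ (by norm_num) (by positivity)]
        linarith
      · push Not at h3
        rw [← Real.sin_pi_sub]
        refine (min_le_right _ _).trans (le_trans ?_ (Real.mul_le_sin (by linarith) (by linarith)))
        rw [div_mul_eq_mul_div]
        gcongr
        linarith
    rw [hcos]
    have h4 : min (2 / Real.pi) (m ^ 2 / Real.pi) * θ ≤ m ^ 2 / Real.pi * (2 * Real.pi) :=
      mul_le_mul (min_le_right _ _) (by linarith) h0 (by positivity)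
    have h5 : m ^ 2 / Real.pi * (2 * Real.pi) = 2 * m ^ 2 := by field_simp
    have h6 : m ^ 2 ≤ Real.sin (θ / 2) ^ 2 := pow_le_pow_left₀ hm0.le hsin 2
    linarith

/-- The denominator of `poissonInv`. -/
def den {d : ℕ} (τ : ℝ) (j : Fin d → ℤ) : ℂ :=
  Complex.exp (Complex.I * (τ : ℂ) * ((absZ j : ℝ) : ℂ) ^ 2) - 1 + Complex.I * (τ : ℂ)

lemma absZ_sq_le {d K : ℕ} {j : Fin d → ℤ} (hj : inK d K j) : absZ j ^ 2 ≤ d * (K : ℝ) ^ 2 := by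
  rw [absZ, Real.sq_sqrt (Finset.sum_nonneg fun _ _ => sq_nonneg _)]
  calc ∑ i, ((j i : ℝ)) ^ 2 ≤ ∑ _i : Fin d, (K : ℝ) ^ 2 := by
        refine Finset.sum_le_sum fun i _ => ?_
        have h1 : (-(K : ℝ)) ≤ j i := by exact_mod_cast (hj i).1
        have h2 : (j i : ℝ) ≤ K := by exact_mod_cast (hj i).2.le
        nlinarith
    _ = _ := by simp

lemma absZ_zero_or {d : ℕ} (j : Fin d → ℤ) : absZ j = 0 ∨ 1 ≤ absZ j := by
  by_cases h : j = 0
  · left; simp [h, absZ]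
  · right
    obtain ⟨i, hi⟩ := Function.ne_iff.1 h
    refine le_trans ?_ (abs_le_absZ j i)
    have : 1 ≤ |j i| := Int.one_le_abs hi
    exact_mod_cast this

lemma den_lower {c : ℝ} (hc : c < 2 * Real.pi) :
    ∃ κ : ℝ, 0 < κ ∧ ∀ (d K : ℕ) (τ : ℝ) (j : Fin d → ℤ), 0 < τ → CFL d K τ c → inK d K j →
      κ * (τ * wt j ^ 2) ≤ ‖den τ j‖ := by
  obtain ⟨κ, hκ, h⟩ := den_lower_aux hc
  refine ⟨min κ 1, by positivity, ?_⟩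
  intro d K τ j hτ hcfl hj
  have hθ : τ * absZ j ^ 2 ≤ c := by
    have := absZ_sq_le hj
    have := mul_le_mul_of_nonneg_left this hτ.le
    unfold CFL at hcfl
    linarith
  have hden : den τ j = Complex.exp (Complex.I * ((τ * absZ j ^ 2 : ℝ) : ℂ)) - 1 + Complex.I * (τ : ℂ) := by
    rw [den]; push_cast; ring_nf
  rcases absZ_zero_or j with h0 | h1
  · have : wt j = 1 := by simp [wt, h0]
    rw [this, hden, h0]
    have h2 : min κ 1 * τ ≤ 1 * τ := mul_le_mul_of_nonneg_right (min_le_right _ _) hτ.le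
    simpa [abs_of_pos hτ] using h2
  · have : wt j = absZ j := by simp [wt, h1]
    rw [this, hden]
    refine le_trans ?_ (h _ τ (by positivity) hθ hτ)
    exact mul_le_mul_of_nonneg_right (min_le_left _ _) (by positivity)

lemma den_ne_zero {c : ℝ} (hc : c < 2 * Real.pi) {d K : ℕ} {τ : ℝ} {j : Fin d → ℤ} (hτ : 0 < τ)
    (hcfl : CFL d K τ c) (hj : inK d K j) : den τ j ≠ 0 := by
  obtain ⟨κ, hκ, h⟩ := den_lower hc
  have := h d K τ j hτ hcfl hj
  have h2 : 0 < κ * (τ * wt j ^ 2) := by have := wt_pos j; positivity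
  exact norm_pos_iff.1 (h2.trans_le this)

lemma isTrig.poissonInv {d K : ℕ} (τ : ℝ) {v : Coef d} (hv : isTrig d K v) :
    isTrig d K (poissonInv d τ v) := by
  intro j hj; simp [Zak.poissonInv, hv j hj]

lemma poissonInv_sub {d : ℕ} (τ : ℝ) (v w : Coef d) :
    poissonInv d τ v - poissonInv d τ w = poissonInv d τ (v - w) := by
  funext j; simp [poissonInv]; ring

lemma poisson_bound {c : ℝ} (hc : c < 2 * Real.pi) :
    ∃ C : ℝ, 0 ≤ C ∧ ∀ (d K : ℕ) [NeZero K] (τ s : ℝ) (v : Coef d), 0 < τ → CFL d K τ c →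
      isTrig d K v → sobNorm (s + 2) (poissonInv d τ v) ≤ C * sobNorm s v := by
  obtain ⟨κ, hκ, h⟩ := den_lower hc
  refine ⟨κ⁻¹, by positivity, ?_⟩
  intro d K _ τ s v hτ hcfl hv
  refine sob_le_of (hv.poissonInv τ) hv (by positivity) fun j hj => ?_
  have h1 := h d K τ j hτ hcfl hj
  have hw := wt_pos j
  have hpos : 0 < ‖den τ j‖ := lt_of_lt_of_le (by positivity) h1
  have e : ‖poissonInv d τ v j‖ = τ / ‖den τ j‖ * ‖v j‖ := by
    change ‖(Complex.I * (τ : ℂ) / den τ j) * v j‖ = _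
    rw [norm_mul, norm_div]
    simp [abs_of_pos hτ]
  rw [e, Real.rpow_add hw]
  have h2 : wt j ^ (2 : ℝ) = wt j ^ 2 := by exact_mod_cast Real.rpow_natCast (wt j) 2
  rw [h2]
  have hr : 0 < wt j ^ s := Real.rpow_pos_of_pos hw s
  have h3 : wt j ^ 2 * (τ / ‖den τ j‖) ≤ κ⁻¹ := by
    rw [← mul_div_assoc, div_le_iff₀ hpos, inv_mul_eq_div, le_div_iff₀ hκ]
    linarith
  calc _ = (wt j ^ 2 * (τ / ‖den τ j‖)) * (wt j ^ s * ‖v j‖) := by ring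
    _ ≤ _ := mul_le_mul_of_nonneg_right h3 (by positivity)

/-! ### Equality `ψ_{P,n} = ψ_n` -/

lemma sinc_id1 (y : ℝ) : sinc y * Real.cos y + y / 2 * sinc (y / 2) ^ 2 * Real.sin y = sinc y := by
  by_cases h : y = 0
  · simp [h, sinc]
  · have h2 : y / 2 ≠ 0 := by simpa using h
    rw [sinc, sinc, if_neg h, if_neg h2]
    have h3 : Real.cos y = 1 - 2 * Real.sin (y / 2) ^ 2 := cos_half_aux y
    rw [h3]; field_simp; ring

lemma sinc_id2 (y : ℝ) : sinc y ^ 2 = sinc (y / 2) ^ 2 * (1 + Real.cos y) / 2 := by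
  by_cases h : y = 0
  · simp [h, sinc]
  · have h2 : y / 2 ≠ 0 := by simpa using h
    rw [sinc, sinc, if_neg h, if_neg h2]
    have h3 : Real.cos y = 1 - 2 * Real.sin (y / 2) ^ 2 := cos_half_aux y
    have h4 : Real.sin y = 2 * Real.sin (y / 2) * Real.cos (y / 2) := by
      rw [← Real.sin_two_mul]; congr 1; ring
    have h5 := Real.sin_sq_add_cos_sq (y / 2)
    have h6 : Real.cos (y / 2) ^ 2 = 1 - Real.sin (y / 2) ^ 2 := by linarith
    rw [h3, h4]; field_simp; rw [h6]; ring

lemma vNew_eq_vOrig {d K : ℕ} {τ : ℝ} {ψn un udn : ℕ → Coef d} (h : LieTrotter d K τ ψn un udn)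
    (n : ℕ) : vNew d K τ (un (n + 1)) (udn (n + 1)) (ψn n) = vOrig d K τ (un n) (udn n) (ψn n) := by
  obtain ⟨_, h2, h3⟩ := h n
  rw [h2, h3, vNew, vOrig]
  generalize interp d K (absSq (ψn n)) = q
  funext j
  have A := congrArg (fun x : ℝ => (x : ℂ)) (sinc_id1 (τ * absZ j))
  have B := congrArg (fun x : ℝ => (x : ℂ)) (sinc_id2 (τ * absZ j))
  simp only [uStep, Rop, sincOp, sincHalfSqOp, sincm1Op, mulOp, Pi.add_apply,
    Pi.sub_apply, Pi.smul_apply, smul_eq_mul, Pi.zero_apply]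
  push_cast at A B ⊢
  linear_combination (un n j + q j) * A + τ * udn n j * B

section ident
variable {d K : ℕ}

lemma isTrig_psiStep (τ : ℝ) (v p : Coef d) : isTrig d K (psiStep d K τ v p) := by
  rw [psiStep, freeOp]; exact (isTrig_interp d K _).mulOp _

lemma freeOp_cancel (τ : ℝ) (v : Coef d) : freeOpInv τ (freeOp τ v) = v := by
  funext j
  simp only [freeOpInv, freeOp, mulOp]
  rw [← mul_assoc, ← Complex.exp_add]
  have : Complex.I * (τ : ℂ) * ((absZ j : ℝ) : ℂ) ^ 2
      + -Complex.I * (τ : ℂ) * ((absZ j : ℝ) : ℂ) ^ 2 = 0 := by ring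
  rw [this]; simp

lemma isTrig.uStep {τ : ℝ} {u ud q : Coef d} (hu : isTrig d K u) (hud : isTrig d K ud)
    (hq : isTrig d K q) : isTrig d K (uStep τ u ud q).1 ∧ isTrig d K (uStep τ u ud q).2 := by
  constructor <;>
  · intro j hj
    simp [Zak.uStep, Rop, hu j hj, hud j hj, hq j hj]

lemma isTrig.vNew {τ : ℝ} {u ud p : Coef d} (hu : isTrig d K u) (hud : isTrig d K ud) :
    isTrig d K (vNew d K τ u ud p) :=
  ((hu.mulOp _).sub ((hud.mulOp _).smul _)).add ((isTrig_interp d K _).mulOp _)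

lemma trig_all {τ t₀ : ℝ} {ψ u ud : ℝ → Coef d} {ψn un udn : ℕ → Coef d}
    (h : LieTrotter d K τ ψn un udn) (h0 : initFull d K t₀ ψ u ud ψn un udn) (n : ℕ) :
    isTrig d K (ψn n) ∧ isTrig d K (un n) ∧ isTrig d K (udn n) := by
  induction n with
  | zero =>
    obtain ⟨h1, h2, h3⟩ := h0
    rw [h1, h2, h3]
    exact ⟨isTrig_interp _ _ _, isTrig_interp _ _ _, isTrig_interp _ _ _⟩
  | succ n ih =>
    obtain ⟨h1, h2, h3⟩ := h n
    rw [h1, h2, h3]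
    have := isTrig.uStep (τ := τ) ih.2.1 ih.2.2 (isTrig_interp d K (absSq (ψn n)))
    exact ⟨isTrig_psiStep _ _ _, this.1, this.2⟩

variable [NeZero K] [hd : Fact (1 ≤ d)]

lemma psiP_eq {c τ : ℝ} (hc : c < 2 * Real.pi) (hτ : 0 < τ) (hcfl : CFL d K τ c)
    {v p p' : Coef d} (hv : isTrig d K v) (hp : isTrig d K p) (hp' : p' = psiStep d K τ v p) :
    psiPNew d K τ (((τ : ℂ))⁻¹ • (p' - p)) p' v = p' := by
  have hs : Fact ((d : ℝ) / 2 < (d : ℝ)) := ⟨by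
    have : (0 : ℝ) < d := by exact_mod_cast hd.out
    linarith⟩
  have hτC : (τ : ℂ) ≠ 0 := by exact_mod_cast hτ.ne'
  have htp' : isTrig d K p' := by rw [hp']; exact isTrig_psiStep _ _ _
  have hf : freeOpInv τ p' = interp d K (conv (expC ((-Complex.I * (τ : ℂ)) • v)) p) := by
    rw [hp', psiStep, freeOp_cancel]
  have hft : isTrig d K (freeOpInv τ p') := htp'.mulOp _
  have hsv := hv.ss
  have hPf : Cyc.P d K d (freeOpInv τ p')
      = NormedSpace.exp (-((Complex.I * (τ : ℂ)) • Cyc.P d K d v)) * Cyc.P d K d p := by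
    rw [hf, P_interp (((hsv.smul _).expC).conv hp.ss), P_conv ((hsv.smul _).expC) hp.ss,
      P_expC (hsv.smul _), P_smul _ hsv, neg_mul, neg_smul]
  have hJ := P_Jn (K := K) (s := d) (τ := τ) hsv hft.ss
  have hinv : NormedSpace.exp ((Complex.I * (τ : ℂ)) • Cyc.P d K d v)
      * NormedSpace.exp (-((Complex.I * (τ : ℂ)) • Cyc.P d K d v)) = 1 := by
    letI : NormedAlgebra ℚ (Cyc d K d) := NormedAlgebra.restrictScalars ℚ ℂ _
    rw [← NormedSpace.exp_add, add_neg_cancel, NormedSpace.exp_zero]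
  have hJ2 : (Complex.I * (τ : ℂ)) • Cyc.P d K d (Jn τ v (freeOpInv τ p'))
      = Cyc.P d K d (p - freeOpInv τ p') := by
    rw [hJ, P_sub hp.ss hft.ss, sub_mul, one_mul]
    congr 1
    rw [hPf, ← mul_assoc, hinv, one_mul]
  have hz : Complex.I * (τ : ℂ) ≠ 0 := mul_ne_zero Complex.I_ne_zero hτC
  have hJ3 : Cyc.P d K d (Jn τ v (freeOpInv τ p'))
      = Cyc.P d K d ((Complex.I * (τ : ℂ))⁻¹ • (p - freeOpInv τ p')) := by
    rw [P_smul _ (hp.sub hft).ss, ← hJ2, smul_smul, inv_mul_cancel₀ hz, one_smul]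
  have hJ4 := interp_eq_of_P (hsv.Jn hft.ss) ((hp.sub hft).smul _).ss hJ3
  rw [interp_trig ((hp.sub hft).smul _)] at hJ4
  have htq : isTrig d K (Complex.I • (((τ : ℂ))⁻¹ • (p' - p)) + p') :=
    (((htp'.sub hp).smul _).smul _).add htp'
  have hmain : interp d K (Complex.I • (((τ : ℂ))⁻¹ • (p' - p)) + p' -
      conv v (conv (phiC ((Complex.I * (τ : ℂ)) • v)) (freeOpInv τ p')))
      = Complex.I • (((τ : ℂ))⁻¹ • (p' - p)) + p'
        - (Complex.I * (τ : ℂ))⁻¹ • (p - freeOpInv τ p') := by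
    have := interp_sub (K := K) htq.ss (hsv.Jn (τ := τ) hft.ss)
    rw [hJ4, interp_trig htq] at this
    exact this
  rw [psiPNew, hmain]
  funext j
  by_cases hj : inK d K j
  · have hden := den_ne_zero hc hτ hcfl hj
    change Complex.I * (τ : ℂ) / den τ j * _ = _
    have hE : freeOpInv τ p' j = (den τ j + 1 - Complex.I * (τ : ℂ)) * p' j := by
      simp only [freeOpInv, mulOp, den]; ring
    simp only [Pi.add_apply, Pi.sub_apply, Pi.smul_apply, smul_eq_mul, hE]
    have hI : Complex.I ^ 2 = -1 := Complex.I_sq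
    field_simp
    linear_combination (p' j - p j) * hI
  · rw [htp' j hj]
    simp [poissonInv, htp' j hj, hp j hj, freeOpInv, mulOp]

end ident


/-! ### The wave step -/
section wave
variable {d K : ℕ} [NeZero K]

lemma rot_id (C S : ℝ) (h : C ^ 2 + S ^ 2 = 1) (A B : ℂ) :
    ‖(C : ℂ) * A + (S : ℂ) * B‖ ^ 2 + ‖-(S : ℂ) * A + (C : ℂ) * B‖ ^ 2 = ‖A‖ ^ 2 + ‖B‖ ^ 2 := by
  simp only [Complex.sq_norm, Complex.normSq_apply]
  simp
  linear_combination (A.re ^ 2 + A.im ^ 2 + B.re ^ 2 + B.im ^ 2) * h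

lemma pair_eq {v w : Coef d} (hv : isTrig d K v) (hw : isTrig d K w) (s : ℝ) :
    pairNorm s v w = Real.sqrt (∑ q : Qd d K, Wq s q ^ 2 * (wt (rep q) ^ 2 * ‖v (rep q)‖ ^ 2 + ‖w (rep q)‖ ^ 2)) := by
  rw [pairNorm, sob_eq hv, sob_eq hw, nq, nq, Real.sq_sqrt (Finset.sum_nonneg fun _ _ => sq_nonneg _),
    Real.sq_sqrt (Finset.sum_nonneg fun _ _ => sq_nonneg _), ← Finset.sum_add_distrib]
  congr 1
  refine Finset.sum_congr rfl fun q _ => ?_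
  have : Wq (s + 1) q = Wq s q * wt (rep q) := by
    rw [Wq, Wq, Real.rpow_add (wt_pos _), Real.rpow_one]
  rw [this]; ring

lemma pair_add_le {x y x' y' : Coef d} (hx : isTrig d K x) (hy : isTrig d K y)
    (hx' : isTrig d K x') (hy' : isTrig d K y') (s : ℝ) :
    pairNorm s (x + x') (y + y') ≤ pairNorm s x y + (sobNorm (s + 1) x' + sobNorm s y') := by
  have h1 := sob_add_le hx hx' (s + 1)
  have h2 := sob_add_le hy hy' s
  obtain ⟨h3, h4⟩ := pair_le s x y
  have hp : pairNorm s x y ^ 2 = sobNorm (s + 1) x ^ 2 + sobNorm s y ^ 2 :=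
    Real.sq_sqrt (by positivity)
  have n1 := sob_nonneg (s + 1) x
  have n2 := sob_nonneg s y
  have n3 := sob_nonneg (s + 1) x'
  have n4 := sob_nonneg s y'
  have n5 := sob_nonneg (s + 1) (x + x')
  have n6 := sob_nonneg s (y + y')
  have n0 : 0 ≤ pairNorm s x y := Real.sqrt_nonneg _
  rw [pairNorm]
  refine Real.sqrt_le_iff.2 ⟨by linarith, ?_⟩
  have e1 : sobNorm (s + 1) (x + x') ^ 2 ≤ (sobNorm (s + 1) x + sobNorm (s + 1) x') ^ 2 :=
    pow_le_pow_left₀ n5 h1 2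
  have e2 : sobNorm s (y + y') ^ 2 ≤ (sobNorm s y + sobNorm s y') ^ 2 :=
    pow_le_pow_left₀ n6 h2 2
  have e3 := mul_le_mul_of_nonneg_right h3 n3
  have e4 := mul_le_mul_of_nonneg_right h4 n4
  have e5 := mul_nonneg n0 n3
  have e6 := mul_nonneg n0 n4
  have e7 := mul_nonneg n3 n4
  nlinarith

lemma abs_cos_sub_one_le (y : ℝ) : |Real.cos y - 1| ≤ |y| := by
  rw [cos_half_aux y]
  have h1 : |Real.sin (y / 2)| ≤ |y / 2| := Real.abs_sin_le_abs
  have h2 := Real.abs_sin_le_one (y / 2)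
  have h3 : |1 - 2 * Real.sin (y / 2) ^ 2 - 1| = 2 * (|Real.sin (y / 2)| * |Real.sin (y / 2)|) := by
    rw [abs_mul_abs_self, show 1 - 2 * Real.sin (y / 2) ^ 2 - 1 = -(2 * (Real.sin (y / 2) * Real.sin (y / 2))) by ring,
      abs_neg, abs_of_nonneg]
    nlinarith [mul_self_nonneg (Real.sin (y / 2))]
  rw [h3]
  have h4 : |y / 2| = |y| / 2 := by rw [abs_div]; norm_num
  nlinarith [abs_nonneg (Real.sin (y / 2)), mul_le_mul h1 h2 (abs_nonneg _) (abs_nonneg _)]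

lemma absZ_le_wt (j : Fin d → ℤ) : absZ j ≤ wt j := le_max_left _ _

lemma rpow_wt1 (j : Fin d → ℤ) (s : ℝ) : wt j ^ (s + 1) = wt j ^ s * wt j := by
  rw [Real.rpow_add (wt_pos _), Real.rpow_one]

lemma rpow_wt2 (j : Fin d → ℤ) (s : ℝ) : wt j ^ (s + 2) = wt j ^ s * wt j ^ 2 := by
  rw [Real.rpow_add (wt_pos _)]
  congr 1
  exact_mod_cast Real.rpow_natCast (wt j) 2

lemma wave_le {τ : ℝ} (hτ : 0 < τ) (s : ℝ) {a b q : Coef d} (ha : isTrig d K a)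
    (hb : isTrig d K b) (hq : isTrig d K q) :
    pairNorm s (uStep τ a b q).1 (uStep τ a b q).2
      ≤ pairNorm s a b + (τ * sobNorm s b + 2 * τ * sobNorm (s + 2) q) := by
  classical
  set X1 : Coef d := fun j => ((Real.cos (τ * absZ j) : ℝ) : ℂ) * a j
    + (if absZ j = 0 then 0 else ((τ * sinc (τ * absZ j) : ℝ) : ℂ) * b j) with hX1
  set X2 : Coef d := (Rop τ (a, b)).2 with hX2
  set Z1 : Coef d := fun j => if absZ j = 0 then (τ : ℂ) * b j else 0 with hZ1
  set Z2 : Coef d := fun j => ((Real.cos (τ * absZ j) - 1 : ℝ) : ℂ) * q j with hZ2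
  set Y2 : Coef d := fun j => -(((absZ j * Real.sin (τ * absZ j) : ℝ)) : ℂ) * q j with hY2
  have tX1 : isTrig d K X1 := by intro j hj; simp [hX1, ha j hj, hb j hj]
  have tX2 : isTrig d K X2 := by intro j hj; simp [hX2, Rop, ha j hj, hb j hj]
  have tZ1 : isTrig d K Z1 := by intro j hj; simp [hZ1, hb j hj]
  have tZ2 : isTrig d K Z2 := by intro j hj; simp [hZ2, hq j hj]
  have tY2 : isTrig d K Y2 := by intro j hj; simp [hY2, hq j hj]
  have e1 : (uStep τ a b q).1 = X1 + (Z1 + Z2) := by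
    funext j
    by_cases h : absZ j = 0
    · simp [uStep, Rop, hX1, hZ1, hZ2, h, sinc]
    · simp [uStep, Rop, hX1, hZ1, hZ2, h]; ring
  have e2 : (uStep τ a b q).2 = X2 + Y2 := by
    funext j
    simp [uStep, Rop, hX2, hY2]
  have hX : pairNorm s X1 X2 = pairNorm s a b := by
    rw [pair_eq tX1 tX2, pair_eq ha hb]
    congr 1
    refine Finset.sum_congr rfl fun p _ => ?_
    congr 1
    generalize rep p = j
    rcases absZ_zero_or j with h | h
    · have hw : wt j = 1 := by simp [wt, h]
      simp [hX1, hX2, Rop, h, hw]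
    · have hw : wt j = absZ j := by simp [wt, h]
      have h0 : absZ j ≠ 0 := by linarith
      have hr := rot_id (Real.cos (τ * absZ j)) (Real.sin (τ * absZ j))
        (by rw [add_comm]; exact Real.sin_sq_add_cos_sq _) ((absZ j : ℂ) * a j) (b j)
      have f1 : ((Real.cos (τ * absZ j) : ℝ) : ℂ) * ((absZ j : ℂ) * a j)
          + ((Real.sin (τ * absZ j) : ℝ) : ℂ) * b j = (absZ j : ℂ) * X1 j := by
        simp only [hX1, if_neg h0]
        rw [← x_sinc (τ * absZ j)]
        push_cast; ring
      have f2 : -((Real.sin (τ * absZ j) : ℝ) : ℂ) * ((absZ j : ℂ) * a j)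
          + ((Real.cos (τ * absZ j) : ℝ) : ℂ) * b j = X2 j := by
        simp only [hX2, Rop]
        push_cast; ring
      rw [f1, f2, norm_mul, norm_mul, mul_pow, mul_pow] at hr
      have hn : ‖(absZ j : ℂ)‖ = absZ j := by simp [absZ_nonneg]
      rw [hn] at hr
      rw [hw]; exact hr
  have bZ1 : sobNorm (s + 1) Z1 ≤ τ * sobNorm s b := by
    refine sob_le_of tZ1 hb hτ.le fun j _ => ?_
    by_cases h : absZ j = 0
    · have hw : wt j = 1 := by simp [wt, h]
      simp [hZ1, h, hw, abs_of_pos hτ]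
    · have := wt_pos j
      simp only [hZ1, if_neg h, norm_zero, mul_zero]
      positivity
  have bZ2 : sobNorm (s + 1) Z2 ≤ τ * sobNorm (s + 2) q := by
    refine sob_le_of tZ2 hq hτ.le fun j _ => ?_
    have hw := wt_pos j
    have hr : 0 < wt j ^ s := Real.rpow_pos_of_pos hw s
    have h1 : ‖((Real.cos (τ * absZ j) - 1 : ℝ) : ℂ)‖ ≤ τ * wt j := by
      rw [Complex.norm_real, Real.norm_eq_abs]
      refine (abs_cos_sub_one_le _).trans ?_
      rw [abs_of_nonneg (mul_nonneg hτ.le (absZ_nonneg j))]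
      exact mul_le_mul_of_nonneg_left (absZ_le_wt j) hτ.le
    rw [rpow_wt1, rpow_wt2]
    simp only [hZ2, norm_mul]
    calc _ ≤ wt j ^ s * wt j * (τ * wt j * ‖q j‖) := by gcongr
      _ = _ := by ring
  have bY2 : sobNorm s Y2 ≤ τ * sobNorm (s + 2) q := by
    refine sob_le_of tY2 hq hτ.le fun j _ => ?_
    have hw := wt_pos j
    have hr : 0 < wt j ^ s := Real.rpow_pos_of_pos hw s
    have h1 : ‖-((absZ j * Real.sin (τ * absZ j) : ℝ) : ℂ)‖ ≤ wt j * (τ * wt j) := by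
      rw [norm_neg, Complex.norm_real, Real.norm_eq_abs, abs_mul, abs_of_nonneg (absZ_nonneg j)]
      have h2 : |Real.sin (τ * absZ j)| ≤ |τ * absZ j| := Real.abs_sin_le_abs
      rw [abs_of_nonneg (mul_nonneg hτ.le (absZ_nonneg j))] at h2
      have h3 := h2.trans (mul_le_mul_of_nonneg_left (absZ_le_wt j) hτ.le)
      exact mul_le_mul (absZ_le_wt j) h3 (abs_nonneg _) hw.le
    rw [rpow_wt2]
    simp only [hY2, norm_mul]
    calc _ ≤ wt j ^ s * (wt j * (τ * wt j) * ‖q j‖) := by gcongr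
      _ = _ := by ring
  rw [e1, e2]
  refine (pair_add_le tX1 tX2 (tZ1.add tZ2) tY2 s).trans ?_
  have := sob_add_le tZ1 tZ2 (s + 1)
  rw [hX]
  linarith

lemma uStep_sub (τ : ℝ) (u ud q u' ud' q' : Coef d) :
    (uStep τ u ud q).1 - (uStep τ u' ud' q').1 = (uStep τ (u - u') (ud - ud') (q - q')).1 ∧
    (uStep τ u ud q).2 - (uStep τ u' ud' q').2 = (uStep τ (u - u') (ud - ud') (q - q')).2 := by
  constructor <;>
  · funext j
    simp [uStep, Rop]; ring

end wave

/-! ### Lipschitz estimates -/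
section lip
variable {d : ℕ} [hd : Fact (1 ≤ d)] {s : ℝ} [hs : Fact ((d : ℝ) / 2 < s)]

lemma vNew_lip {K : ℕ} [NeZero K] {τ : ℝ} (hτ : 0 < τ) {u ud p u' ud' p' : Coef d}
    (hu : isTrig d K u) (hud : isTrig d K ud) (hp : isTrig d K p)
    (hu' : isTrig d K u') (hud' : isTrig d K ud') (hp' : isTrig d K p') :
    sobNorm s (vNew d K τ u ud p - vNew d K τ u' ud' p')
      ≤ sobNorm s (u - u') + τ * sobNorm s (ud - ud')
        + 2 * (Real.sqrt (CSq d s) * ((sobNorm s p + sobNorm s p') * sobNorm s (p - p'))) := by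
  have e : vNew d K τ u ud p - vNew d K τ u' ud' p'
      = sincOp τ (u - u') - ((τ / 2 : ℝ) : ℂ) • sincHalfSqOp τ (ud - ud')
        + sincm1Op τ (interp d K (absSq p) - interp d K (absSq p')) := by
    rw [vNew, vNew, sincOp, sincHalfSqOp, sincm1Op, ← mulOp_sub, ← mulOp_sub, ← mulOp_sub, smul_sub]
    abel
  have tq := (isTrig_interp d K (absSq p)).sub (isTrig_interp d K (absSq p'))
  have t1 : isTrig d K (sincOp τ (u - u')) := (hu.sub hu').mulOp _
  have t2 : isTrig d K (sincHalfSqOp τ (ud - ud')) := (hud.sub hud').mulOp _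
  have t3 : isTrig d K (sincm1Op τ (interp d K (absSq p) - interp d K (absSq p'))) := tq.mulOp _
  have b1 : sobNorm s (sincOp τ (u - u')) ≤ 1 * sobNorm s (u - u') :=
    sob_mulOp_le (hu.sub hu') s zero_le_one fun x => by
      rw [Complex.norm_real]; exact abs_sinc_le _
  have b2 : sobNorm s (sincHalfSqOp τ (ud - ud')) ≤ 1 * sobNorm s (ud - ud') :=
    sob_mulOp_le (hud.sub hud') s zero_le_one fun x => by
      rw [Complex.norm_real, norm_pow]; exact pow_le_one₀ (norm_nonneg _) (abs_sinc_le _)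
  have b3 : sobNorm s (sincm1Op τ (interp d K (absSq p) - interp d K (absSq p')))
      ≤ 2 * sobNorm s (interp d K (absSq p) - interp d K (absSq p')) :=
    sob_mulOp_le tq s zero_le_two fun x => by
      rw [Complex.norm_real, Real.norm_eq_abs]
      have := abs_le.1 (abs_sinc_le (τ * x))
      rw [abs_le]; constructor <;> linarith
  have b4 := absSq_lip (s := s) hp hp'
  have b5 := sob_smul_le t2 s ((τ / 2 : ℝ) : ℂ)
  have hn : ‖((τ / 2 : ℝ) : ℂ)‖ = τ / 2 := by
    rw [Complex.norm_real, Real.norm_eq_abs, abs_of_pos (by positivity)]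
  rw [hn] at b5
  rw [e]
  have a1 := sob_add_le (t1.sub (t2.smul ((τ / 2 : ℝ) : ℂ))) t3 s
  have a2 := sob_sub_le t1 (t2.smul ((τ / 2 : ℝ) : ℂ)) s
  have n1 := sob_nonneg s (ud - ud')
  have b6 : τ / 2 * sobNorm s (sincHalfSqOp τ (ud - ud')) ≤ τ / 2 * (1 * sobNorm s (ud - ud')) :=
    mul_le_mul_of_nonneg_left b2 (by positivity)
  have b7 : 0 ≤ τ * sobNorm s (ud - ud') := by positivity
  linarith

lemma psiP_lip {c κ : ℝ} (hκ : ∀ (d K : ℕ) [NeZero K] (τ s : ℝ) (v : Coef d), 0 < τ → CFL d K τ c →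
      isTrig d K v → sobNorm (s + 2) (poissonInv d τ v) ≤ κ * sobNorm s v) (hκ0 : 0 ≤ κ)
    {K : ℕ} [NeZero K] {τ D : ℝ} (hτ : 0 < τ) (hcfl : CFL d K τ c) {φ p v φ' p' v' : Coef d}
    (hφ : isTrig d K φ) (hp : isTrig d K p) (hv : isTrig d K v)
    (hφ' : isTrig d K φ') (hp' : isTrig d K p') (hv' : isTrig d K v')
    (hD : τ * (Real.sqrt (CSq d s) * sobNorm s v) ≤ D)
    (hD' : τ * (Real.sqrt (CSq d s) * sobNorm s v') ≤ D) :
    sobNorm (s + 2) (psiPNew d K τ φ p v - psiPNew d K τ φ' p' v')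
      ≤ κ * (sobNorm s (φ - φ') + sobNorm s (p - p')
        + Real.sqrt (CSq d s) * ((1 + D * Real.exp D) * Real.exp (2 * D)
          * sobNorm s (v - v') * sobNorm s p
        + sobNorm s v' * Real.exp D * sobNorm s (p - p'))) := by
  have hfree : ∀ {x : Coef d}, isTrig d K x → sobNorm s (freeOpInv τ x) ≤ sobNorm s x := by
    intro x hx
    have := sob_mulOp_le hx s (g := fun x => Complex.exp (Complex.I * (τ : ℂ) * ((x : ℂ)) ^ 2))
      zero_le_one fun x => by
        rw [show Complex.I * (τ : ℂ) * ((x : ℂ)) ^ 2 = ((τ * x ^ 2 : ℝ) : ℂ) * Complex.I by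
          push_cast; ring, Complex.norm_exp_ofReal_mul_I]
    rw [one_mul] at this
    exact this
  have tf : isTrig d K (freeOpInv τ p) := hp.mulOp _
  have tf' : isTrig d K (freeOpInv τ p') := hp'.mulOp _
  have hJ := Jn_lip hτ hv hv' tf tf' hD hD'
  have hsubf : freeOpInv τ p - freeOpInv τ p' = freeOpInv τ (p - p') := mulOp_sub _ _ _
  rw [hsubf] at hJ
  have g1 := hfree hp
  have g2 := hfree (hp.sub hp')
  have tJ := (isTrig_interp d K (Jn τ v (freeOpInv τ p))).sub
    (isTrig_interp d K (Jn τ v' (freeOpInv τ p')))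
  have t1 := (hφ.smul Complex.I).add hp
  have t1' := (hφ'.smul Complex.I).add hp'
  have i1 := interp_sub (K := K) t1.ss (hv.ss.Jn (τ := τ) tf.ss)
  have i2 := interp_sub (K := K) t1'.ss (hv'.ss.Jn (τ := τ) tf'.ss)
  rw [interp_trig t1] at i1
  rw [interp_trig t1'] at i2
  have e : psiPNew d K τ φ p v - psiPNew d K τ φ' p' v'
      = poissonInv d τ ((Complex.I • (φ - φ') + (p - p'))
        - (interp d K (Jn τ v (freeOpInv τ p)) - interp d K (Jn τ v' (freeOpInv τ p')))) := by
    rw [psiPNew, psiPNew, poissonInv_sub]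
    congr 1
    refine (congrArg₂ (· - ·) i1 i2).trans ?_
    simp only [smul_sub]
    abel
  have t2 := ((hφ.sub hφ').smul Complex.I).add (hp.sub hp')
  rw [e]
  refine (hκ d K τ s _ hτ hcfl (t2.sub tJ)).trans (mul_le_mul_of_nonneg_left ?_ hκ0)
  have a1 := sob_sub_le t2 tJ s
  have a2 := sob_add_le ((hφ.sub hφ').smul Complex.I) (hp.sub hp') s
  have a3 := sob_smul_le (hφ.sub hφ') s Complex.I
  rw [Complex.norm_I, one_mul] at a3
  have hD0 : 0 ≤ D := le_trans (by have := sob_nonneg s v; positivity) hD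
  have n1 := sob_nonneg s v'
  have n2 := sob_nonneg s (v - v')
  have a4 : Real.sqrt (CSq d s) * ((1 + D * Real.exp D) * Real.exp (2 * D)
          * sobNorm s (v - v') * sobNorm s (freeOpInv τ p)
        + sobNorm s v' * Real.exp D * sobNorm s (freeOpInv τ (p - p')))
      ≤ Real.sqrt (CSq d s) * ((1 + D * Real.exp D) * Real.exp (2 * D)
          * sobNorm s (v - v') * sobNorm s p
        + sobNorm s v' * Real.exp D * sobNorm s (p - p')) := by
    gcongr
  linarith

end lip


/-! ### Combined Lipschitz estimates with uniform constants -/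
section comb
variable {d : ℕ}

lemma isTrig_zero (d K : ℕ) : isTrig d K (0 : Coef d) := fun _ _ => rfl

lemma conv_zero_left (w : Coef d) : conv (0 : Coef d) w = 0 := by
  funext j; simp [conv]

lemma interp_zero (d K : ℕ) : interp d K (0 : Coef d) = 0 := by
  funext j; simp [interp]

lemma mulOp_zero (g : ℝ → ℂ) : mulOp g (0 : Coef d) = 0 := by
  funext j; simp [mulOp]

lemma vNew_zero (K : ℕ) (τ : ℝ) : vNew d K τ 0 0 0 = 0 := by
  simp [vNew, sincOp, sincHalfSqOp, sincm1Op, mulOp_zero, absSq, conv_zero_left, interp_zero]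

lemma psiPNew_zero (K : ℕ) (τ : ℝ) : psiPNew d K τ 0 0 0 = 0 := by
  rw [psiPNew]
  simp only [conv_zero_left, smul_zero, add_zero, sub_zero, interp_zero]
  funext j; simp [poissonInv]

lemma vNew_lip' (d : ℕ) [hd : Fact (1 ≤ d)] (s : ℝ) [hs : Fact ((d : ℝ) / 2 < s)] {B T : ℝ} (hB : 0 ≤ B) (hT : 0 < T) :
    ∃ C : ℝ, 0 ≤ C ∧ ∀ (K : ℕ) [NeZero K] (τ : ℝ), 0 < τ → τ ≤ T →
      ∀ u ud p u' ud' p' : Coef d, isTrig d K u → isTrig d K ud → isTrig d K p →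
      isTrig d K u' → isTrig d K ud' → isTrig d K p' → sobNorm s p ≤ B → sobNorm s p' ≤ B →
      sobNorm s (vNew d K τ u ud p - vNew d K τ u' ud' p')
        ≤ C * (sobNorm s (u - u') + sobNorm s (ud - ud') + sobNorm s (p - p')) := by
  refine ⟨1 + T + 4 * Real.sqrt (CSq d s) * B, by positivity, ?_⟩
  intro K _ τ hτ hτT u ud p u' ud' p' hu hud hp hu' hud' hp' b b'
  refine (vNew_lip hτ hu hud hp hu' hud' hp').trans ?_
  have n1 := sob_nonneg s (u - u')
  have n2 := sob_nonneg s (ud - ud')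
  have n3 := sob_nonneg s (p - p')
  have n4 := Real.sqrt_nonneg (CSq d s)
  have h1 : (sobNorm s p + sobNorm s p') * sobNorm s (p - p') ≤ (2 * B) * sobNorm s (p - p') :=
    mul_le_mul_of_nonneg_right (by linarith) n3
  have h2 := mul_le_mul_of_nonneg_left h1 n4
  have h3 := mul_le_mul_of_nonneg_right hτT n2
  have n5 : 0 ≤ Real.sqrt (CSq d s) * B := by positivity
  nlinarith [mul_nonneg hT.le n1, mul_nonneg hT.le n3, mul_nonneg n5 n1, mul_nonneg n5 n2]

lemma A_lip (d : ℕ) [hd : Fact (1 ≤ d)] (s : ℝ) [hs : Fact ((d : ℝ) / 2 < s)]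
    {B T c : ℝ} (hB : 0 ≤ B) (hT : 0 < T) (hc : c < 2 * Real.pi) :
    ∃ C : ℝ, 0 ≤ C ∧ ∀ (K : ℕ) [NeZero K] (τ : ℝ), 0 < τ → τ ≤ T → CFL d K τ c →
      ∀ φ p u ud r φ' p' u' ud' r' : Coef d,
      isTrig d K φ → isTrig d K p → isTrig d K u → isTrig d K ud → isTrig d K r →
      isTrig d K φ' → isTrig d K p' → isTrig d K u' → isTrig d K ud' → isTrig d K r' →
      sobNorm s p ≤ B → sobNorm s u ≤ B → sobNorm s ud ≤ B → sobNorm s r ≤ B →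
      sobNorm s p' ≤ B → sobNorm s u' ≤ B → sobNorm s ud' ≤ B → sobNorm s r' ≤ B →
      sobNorm (s + 2) (psiPNew d K τ φ p (vNew d K τ u ud r)
          - psiPNew d K τ φ' p' (vNew d K τ u' ud' r'))
        ≤ C * (sobNorm s (φ - φ') + sobNorm s (p - p') + sobNorm s (u - u')
          + sobNorm s (ud - ud') + sobNorm s (r - r')) := by
  obtain ⟨Cv, hCv, hv⟩ := vNew_lip' d s hB hT
  obtain ⟨κ, hκ0, hκ⟩ := poisson_bound hc
  set S := Real.sqrt (CSq d s) with hS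
  have hS0 : 0 ≤ S := Real.sqrt_nonneg _
  set Bv := Cv * (3 * B) with hBv
  have hBv0 : 0 ≤ Bv := by positivity
  set D := T * (S * Bv) with hD
  have hD0 : 0 ≤ D := by positivity
  set E := (1 + D * Real.exp D) * Real.exp (2 * D) with hE
  have hE0 : 0 ≤ E := by positivity
  refine ⟨κ * (1 + S * (E * Cv * B + Bv * Real.exp D)), by positivity, ?_⟩
  intro K _ τ hτ hτT hcfl φ p u ud r φ' p' u' ud' r' tφ tp tu tud tr tφ' tp' tu' tud' tr'
    bp bu bud br bp' bu' bud' br'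
  have hvb : ∀ u ud r : Coef d, isTrig d K u → isTrig d K ud → isTrig d K r →
      sobNorm s u ≤ B → sobNorm s ud ≤ B → sobNorm s r ≤ B →
      sobNorm s (vNew d K τ u ud r) ≤ Bv := by
    intro u ud r tu tud tr bu bud br
    have z := isTrig_zero d K
    have h := hv K τ hτ hτT u ud r 0 0 0 tu tud tr z z z br (by rw [sob_zero]; exact hB)
    rw [vNew_zero, sub_zero, sub_zero, sub_zero, sub_zero] at h
    exact h.trans (mul_le_mul_of_nonneg_left (by linarith) hCv)
  have v1 := hvb u ud r tu tud tr bu bud br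
  have v2 := hvb u' ud' r' tu' tud' tr' bu' bud' br'
  have vd := hv K τ hτ hτT u ud r u' ud' r' tu tud tr tu' tud' tr' br br'
  have hDb : ∀ x, 0 ≤ x → x ≤ Bv → τ * (S * x) ≤ D := by
    intro x hx0 hx
    exact mul_le_mul hτT (mul_le_mul_of_nonneg_left hx hS0) (by positivity) hT.le
  have h := psiP_lip (s := s) hκ hκ0 hτ hcfl tφ tp (isTrig.vNew (τ := τ) (p := r) tu tud) tφ' tp'
    (isTrig.vNew (τ := τ) (p := r') tu' tud')
    (hDb _ (sob_nonneg _ _) v1) (hDb _ (sob_nonneg _ _) v2)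
  refine h.trans ?_
  rw [mul_assoc κ]
  refine mul_le_mul_of_nonneg_left ?_ hκ0
  have n1 := sob_nonneg s (φ - φ')
  have n2 := sob_nonneg s (p - p')
  have n3 := sob_nonneg s (u - u')
  have n4 := sob_nonneg s (ud - ud')
  have n5 := sob_nonneg s (r - r')
  rw [← hE]
  set Sg := sobNorm s (φ - φ') + sobNorm s (p - p') + sobNorm s (u - u')
          + sobNorm s (ud - ud') + sobNorm s (r - r') with hSg
  have hSg0 : 0 ≤ Sg := by positivity
  have g1 : E * sobNorm s (vNew d K τ u ud r - vNew d K τ u' ud' r') * sobNorm s p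
      ≤ E * (Cv * Sg) * B := by
    have : sobNorm s (vNew d K τ u ud r - vNew d K τ u' ud' r') ≤ Cv * Sg :=
      vd.trans (mul_le_mul_of_nonneg_left (by linarith) hCv)
    exact mul_le_mul (mul_le_mul_of_nonneg_left this hE0) bp (sob_nonneg _ _) (by positivity)
  have g2 : sobNorm s (vNew d K τ u' ud' r') * Real.exp D * sobNorm s (p - p')
      ≤ Bv * Real.exp D * Sg :=
    mul_le_mul (mul_le_mul_of_nonneg_right v2 (Real.exp_pos D).le) (by linarith) n2 (by positivity)
  have g3 := mul_le_mul_of_nonneg_left (add_le_add g1 g2) hS0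
  have g4 : sobNorm s (φ - φ') + sobNorm s (p - p') ≤ Sg := by linarith
  calc _ ≤ Sg + S * (E * (Cv * Sg) * B + Bv * Real.exp D * Sg) := add_le_add g4 g3
    _ = _ := by ring

lemma isTrig_psiPNew {K : ℕ} (τ : ℝ) (φ p v : Coef d) : isTrig d K (psiPNew d K τ φ p v) :=
  (isTrig_interp d K _).poissonInv τ

lemma q_lip (d : ℕ) [hd : Fact (1 ≤ d)] (s : ℝ) [hs : Fact ((d : ℝ) / 2 < s)]
    {B T c : ℝ} (hB : 0 ≤ B) (hT : 0 < T) (hc : c < 2 * Real.pi) :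
    ∃ C : ℝ, 0 ≤ C ∧ ∀ (K : ℕ) [NeZero K] (τ : ℝ), 0 < τ → τ ≤ T → CFL d K τ c →
      ∀ φ p u ud r φ' p' u' ud' r' : Coef d,
      isTrig d K φ → isTrig d K p → isTrig d K u → isTrig d K ud → isTrig d K r →
      isTrig d K φ' → isTrig d K p' → isTrig d K u' → isTrig d K ud' → isTrig d K r' →
      sobNorm s φ ≤ B → sobNorm s p ≤ B → sobNorm s u ≤ B → sobNorm s ud ≤ B → sobNorm s r ≤ B →
      sobNorm s φ' ≤ B → sobNorm s p' ≤ B → sobNorm s u' ≤ B → sobNorm s ud' ≤ B →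
      sobNorm s r' ≤ B →
      sobNorm (s + 2) (interp d K (absSq (psiPNew d K τ φ p (vNew d K τ u ud r)))
          - interp d K (absSq (psiPNew d K τ φ' p' (vNew d K τ u' ud' r'))))
        ≤ C * (sobNorm s (φ - φ') + sobNorm s (p - p') + sobNorm s (u - u')
          + sobNorm s (ud - ud') + sobNorm s (r - r')) := by
  obtain ⟨C, hC, hA⟩ := A_lip d s hB hT hc
  have hs2 : Fact ((d : ℝ) / 2 < s + 2) := ⟨by have := hs.out; linarith⟩
  set S := Real.sqrt (CSq d (s + 2)) with hS
  have hS0 : 0 ≤ S := Real.sqrt_nonneg _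
  refine ⟨S * ((C * (5 * B) + C * (5 * B)) * C), by positivity, ?_⟩
  intro K _ τ hτ hτT hcfl φ p u ud r φ' p' u' ud' r' tφ tp tu tud tr tφ' tp' tu' tud' tr'
    bφ bp bu bud br bφ' bp' bu' bud' br'
  have hb : ∀ φ p u ud r : Coef d,
      isTrig d K φ → isTrig d K p → isTrig d K u → isTrig d K ud → isTrig d K r →
      sobNorm s φ ≤ B → sobNorm s p ≤ B → sobNorm s u ≤ B → sobNorm s ud ≤ B → sobNorm s r ≤ B →
      sobNorm (s + 2) (psiPNew d K τ φ p (vNew d K τ u ud r)) ≤ C * (5 * B) := by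
    intro φ p u ud r tφ tp tu tud tr bφ bp bu bud br
    have z := isTrig_zero d K
    have z' : sobNorm s (0 : Coef d) ≤ B := by rw [sob_zero]; exact hB
    have h := hA K τ hτ hτT hcfl φ p u ud r 0 0 0 0 0 tφ tp tu tud tr z z z z z bp bu bud br
      z' z' z' z'
    rw [vNew_zero, psiPNew_zero] at h
    simp only [sub_zero] at h
    exact h.trans (mul_le_mul_of_nonneg_left (by linarith) hC)
  have h1 := hb φ p u ud r tφ tp tu tud tr bφ bp bu bud br
  have h2 := hb φ' p' u' ud' r' tφ' tp' tu' tud' tr' bφ' bp' bu' bud' br'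
  have h3 := hA K τ hτ hτT hcfl φ p u ud r φ' p' u' ud' r' tφ tp tu tud tr tφ' tp' tu' tud' tr'
    bp bu bud br bp' bu' bud' br'
  refine (absSq_lip (s := s + 2) (isTrig_psiPNew τ φ p _) (isTrig_psiPNew τ φ' p' _)).trans ?_
  rw [mul_assoc]
  refine mul_le_mul_of_nonneg_left ?_ hS0
  rw [mul_assoc]
  exact mul_le_mul (add_le_add h1 h2) h3 (sob_nonneg _ _) (by positivity)

end comb


/-! ### Final assembly -/

lemma pair_nonneg {d : ℕ} (s : ℝ) (v w : Coef d) : 0 ≤ pairNorm s v w := Real.sqrt_nonneg _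

lemma pair_zero {d : ℕ} (s : ℝ) : pairNorm s (0 : Coef d) 0 = 0 := by
  simp [pairNorm, sob_zero]

lemma isTrig_K0 {d : ℕ} (hd : 1 ≤ d) {v : Coef d} (hv : isTrig d 0 v) : v = 0 := by
  funext j
  refine hv j fun h => ?_
  have := h ⟨0, hd⟩
  simp only [Nat.cast_zero, neg_zero] at this
  lia

lemma isTrig_phiK {d K : ℕ} {ψK uK : ℝ → Coef d} {t : ℝ} (h : isTrig d K (ψK t)) :
    isTrig d K (phiK d K ψK uK t) := by
  intro j hj
  simp [phiK, h j hj, isTrig_interp d K _ j hj]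

lemma errFull_nonneg (d K : ℕ) (s τ t₀ : ℝ) (ψK uK udK : ℝ → Coef d)
    (ψn un udn : ℕ → Coef d) (n : ℕ) : 0 ≤ errFull d K s τ t₀ ψK uK udK ψn un udn n := by
  refine Real.sSup_nonneg ?_
  rintro x ⟨m, _, rfl⟩
  exact add_nonneg (sob_nonneg _ _) (pair_nonneg _ _ _)

lemma le_errFull (d K : ℕ) (s τ t₀ : ℝ) (ψK uK udK : ℝ → Coef d)
    (ψn un udn : ℕ → Coef d) (n m : ℕ) (h1 : 1 ≤ m) (h2 : m ≤ n) :
    sobNorm s (phiK d K ψK uK (t₀ + (m : ℝ) * τ) - phin τ ψn m)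
      + pairNorm s (uK (t₀ + (m : ℝ) * τ) - un m) (udK (t₀ + (m : ℝ) * τ) - udn m)
      ≤ errFull d K s τ t₀ ψK uK udK ψn un udn n :=
  le_csSup ((Set.finite_Icc 1 n).image _).bddAbove ⟨m, ⟨h1, h2⟩, rfl⟩

lemma psi_tele {d : ℕ} {τ : ℝ} (hτ : 0 < τ) (ψn : ℕ → Coef d) (k : ℕ) :
    ψn k = ψn 0 + (τ : ℂ) • ∑ m ∈ Finset.range k, phin τ ψn (m + 1) := by
  have hτC : (τ : ℂ) ≠ 0 := by exact_mod_cast hτ.ne'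
  induction k with
  | zero => simp
  | succ k ih =>
    rw [Finset.sum_range_succ, smul_add, ← add_assoc, ← ih, phin, smul_smul, mul_inv_cancel₀ hτC,
      one_smul]
    simp

/-- **Proposition (stability in `u` and `u̇`).** Under the regularity and a priori
bounds and the CFL condition,
`|||(û_{n+1}^K,û̇_{n+1}^K) - (u_{n+1}^K,u̇_{n+1}^K)|||ₛ
  ≤ |||(u^K(t_n),u̇^K(t_n)) - (u_n^K,u̇_n^K)|||ₛ + C τ e_n^K` for `0 ≤ t_n - t₀ ≤ T`. -/
theorem stability_u (d : ℕ) (hd : 1 ≤ d) (s σ M T c C₀ : ℝ)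
    (hs : (d : ℝ) / 2 < s) (hσ : 2 ≤ σ) (hM : 1 ≤ M) (hT : 0 < T)
    (hc : c < 2 * Real.pi) :
    ∃ C : ℝ, ∀ (K : ℕ) (τ : ℝ), 0 < τ → CFL d K τ c →
      ∀ (ψ u ud ψK uK udK : ℝ → Coef d) (ψn un udn : ℕ → Coef d) (t₀ : ℝ),
        ZakSol d ψ u ud →
        regBound d s σ M T t₀ ψ u ud →
        ZakSolK d K ψK uK udK →
        initK d K t₀ ψ u ud ψK uK udK →
        regHighK d K s C₀ T t₀ ψK uK udK →
        LieTrotter d K τ ψn un udn →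
        initFull d K t₀ ψ u ud ψn un udn →
        aprioriFull s (2 * C₀ * M) T τ ψn un udn →
        ∀ n : ℕ, (n : ℝ) * τ ≤ T →
          pairNorm s ((uhatSucc d K τ t₀ ψK uK udK n).1 - un (n + 1))
              ((uhatSucc d K τ t₀ ψK uK udK n).2 - udn (n + 1))
            ≤ pairNorm s (uK (t₀ + (n : ℝ) * τ) - un n) (udK (t₀ + (n : ℝ) * τ) - udn n)
              + C * τ * errFull d K s τ t₀ ψK uK udK ψn un udn n := by
  have hFd : Fact (1 ≤ d) := ⟨hd⟩
  have hFs : Fact ((d : ℝ) / 2 < s) := ⟨hs⟩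
  set B : ℝ := |C₀| + |2 * C₀ * M| + T * (|C₀| + |2 * C₀ * M|) with hB
  have hB0 : 0 ≤ B := by positivity
  obtain ⟨Cq, hCq0, hCq⟩ := q_lip d s hB0 hT hc
  refine ⟨1 + 2 * (Cq * (3 + 2 * T)), ?_⟩
  intro K τ hτ hcfl ψ u ud ψK uK udK ψn un udn t₀ _ _ hZK hiK hreg hLT hiF hap n hn
  set e := errFull d K s τ t₀ ψK uK udK ψn un udn n with he
  have he0 : 0 ≤ e := errFull_nonneg _ _ _ _ _ _ _ _ _ _ _ _
  have hC0 : 0 ≤ 1 + 2 * (Cq * (3 + 2 * T)) := by positivity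
  have htn := fun k => trig_all hLT hiF k
  obtain ⟨hLT1, hLT2, hLT3⟩ := hLT n
  have hψ0 : ψn 0 = ψK t₀ := hiF.1.trans hiK.1.symm
  have hu0 : un 0 = uK t₀ := hiF.2.1.trans hiK.2.1.symm
  have hud0 : udn 0 = udK t₀ := hiF.2.2.trans hiK.2.2.symm
  have hrhs : 0 ≤ pairNorm s (uK (t₀ + (n : ℝ) * τ) - un n) (udK (t₀ + (n : ℝ) * τ) - udn n)
      + (1 + 2 * (Cq * (3 + 2 * T))) * τ * e :=
    add_nonneg (pair_nonneg _ _ _) (by positivity)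
  rcases Nat.eq_zero_or_pos K with hK | hK
  · subst hK
    have t1 := isTrig.uStep (τ := τ) (hZK.1 (t₀ + (n : ℝ) * τ)).2.1 (hZK.1 (t₀ + (n : ℝ) * τ)).2.2
      (isTrig_interp d 0 (absSq (psiPhat d 0 τ t₀ ψK uK udK n)))
    have z1 : (uhatSucc d 0 τ t₀ ψK uK udK n).1 - un (n + 1) = 0 :=
      isTrig_K0 hd (t1.1.sub (htn (n + 1)).2.1)
    have z2 : (uhatSucc d 0 τ t₀ ψK uK udK n).2 - udn (n + 1) = 0 :=
      isTrig_K0 hd (t1.2.sub (htn (n + 1)).2.2)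
    rw [z1, z2, pair_zero]
    exact hrhs
  have hNK : NeZero K := ⟨hK.ne'⟩
  rcases Nat.eq_zero_or_pos n with hn0 | hn1
  · subst hn0
    have e1 : uhatSucc d K τ t₀ ψK uK udK 0
        = uStep τ (un 0) (udn 0) (interp d K (absSq (ψn 0))) := by
      rw [uhatSucc, psiPhat, if_pos rfl, hψ0, hu0, hud0]
      simp
    rw [hLT2, hLT3, e1, sub_self, sub_self, pair_zero]
    exact hrhs
  -- main case
  have hnR : (1 : ℝ) ≤ n := by exact_mod_cast hn1
  have hτT : τ ≤ T := by nlinarith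
  have htK := hZK.1
  have tφK : ∀ t, isTrig d K (phiK d K ψK uK t) := fun t => isTrig_phiK (htK t).1
  have tφn : ∀ k, isTrig d K (phin τ ψn k) := fun k => ((htn k).1.sub (htn (k - 1)).1).smul _
  have hkT : ∀ k : ℕ, k ≤ n → (k : ℝ) * τ ≤ T := fun k hk =>
    (mul_le_mul_of_nonneg_right (by exact_mod_cast hk) hτ.le).trans hn
  have hR : ∀ k : ℕ, k ≤ n → sobNorm s (ψK (t₀ + (k : ℝ) * τ)) ≤ |C₀| ∧
      sobNorm s (uK (t₀ + (k : ℝ) * τ)) ≤ |C₀| ∧ sobNorm s (udK (t₀ + (k : ℝ) * τ)) ≤ |C₀| ∧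
      sobNorm s (phiK d K ψK uK (t₀ + (k : ℝ) * τ)) ≤ |C₀| := by
    intro k hk
    have h1 := hkT k hk
    have h2 := hreg (t₀ + (k : ℝ) * τ) (by have : 0 ≤ (k : ℝ) * τ := by positivity
                                           linarith) (by linarith)
    generalize t₀ + (k : ℝ) * τ = t at *
    have a0 := le_abs_self C₀
    have a1 := sob_nonneg (s + 4) (ψK t)
    have a2 := pair_nonneg (s + 2) (uK t) (udK t)
    have a3 := sob_nonneg (s + 2) (phiK d K ψK uK t)
    obtain ⟨p1, p2⟩ := pair_le (s + 2) (uK t) (udK t)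
    have m1 := sob_mono (htK t).1 (show s ≤ s + 4 by linarith)
    have m2 := sob_mono (htK t).2.1 (show s ≤ s + 2 + 1 by linarith)
    have m3 := sob_mono (htK t).2.2 (show s ≤ s + 2 by linarith)
    have m4 := sob_mono (tφK t) (show s ≤ s + 2 by linarith)
    refine ⟨?_, ?_, ?_, ?_⟩ <;> linarith
  have hA : ∀ k : ℕ, 1 ≤ k → k ≤ n → sobNorm s (phin τ ψn k) ≤ |2 * C₀ * M| ∧
      sobNorm s (un k) ≤ |2 * C₀ * M| ∧ sobNorm s (udn k) ≤ |2 * C₀ * M| := by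
    intro k hk1 hk
    have h2 := hap k hk1 (hkT k hk)
    have a0 := le_abs_self (2 * C₀ * M)
    have a1 := sob_nonneg s (phin τ ψn k)
    have a2 := pair_nonneg s (un k) (udn k)
    obtain ⟨p1, p2⟩ := pair_le s (un k) (udn k)
    have m2 := sob_mono (htn k).2.1 (show s ≤ s + 1 by linarith)
    refine ⟨?_, ?_, ?_⟩ <;> linarith
  have hE : ∀ k : ℕ, 1 ≤ k → k ≤ n →
      sobNorm s (phiK d K ψK uK (t₀ + (k : ℝ) * τ) - phin τ ψn k) ≤ e ∧
      sobNorm s (uK (t₀ + (k : ℝ) * τ) - un k) ≤ e ∧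
      sobNorm s (udK (t₀ + (k : ℝ) * τ) - udn k) ≤ e := by
    intro k hk1 hk
    have h2 := le_errFull d K s τ t₀ ψK uK udK ψn un udn n k hk1 hk
    rw [← he] at h2
    have a1 := sob_nonneg s (phiK d K ψK uK (t₀ + (k : ℝ) * τ) - phin τ ψn k)
    obtain ⟨p1, p2⟩ := pair_le s (uK (t₀ + (k : ℝ) * τ) - un k) (udK (t₀ + (k : ℝ) * τ) - udn k)
    have m2 := sob_mono ((htK (t₀ + (k : ℝ) * τ)).2.1.sub (htn k).2.1) (show s ≤ s + 1 by linarith)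
    have a2 := sob_nonneg s (udK (t₀ + (k : ℝ) * τ) - udn k)
    refine ⟨?_, ?_, ?_⟩ <;> linarith
  -- sums
  have hsum : ∀ (k : ℕ) (f : ℕ → Coef d) (b : ℝ), k ≤ n → 0 ≤ b → (∀ m, isTrig d K (f m)) →
      (∀ m, m < k → sobNorm s (f m) ≤ b) →
      isTrig d K ((τ : ℂ) • ∑ m ∈ Finset.range k, f m) ∧
      sobNorm s ((τ : ℂ) • ∑ m ∈ Finset.range k, f m) ≤ T * b := by
    intro k f b hk hb tf hf
    obtain ⟨h1, h2⟩ := sob_sum_le (Finset.range k) (fun m _ => tf m) s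
    refine ⟨h1.smul _, ?_⟩
    have h3 := sob_smul_le h1 s (τ : ℂ)
    have h4 : ‖(τ : ℂ)‖ = τ := by simp [abs_of_pos hτ]
    rw [h4] at h3
    have h5 : ∑ m ∈ Finset.range k, sobNorm s (f m) ≤ k * b := by
      calc _ ≤ ∑ _m ∈ Finset.range k, b :=
            Finset.sum_le_sum fun m hm => hf m (Finset.mem_range.1 hm)
        _ = _ := by simp
    calc _ ≤ τ * (k * b) := h3.trans (mul_le_mul_of_nonneg_left (h2.trans h5) hτ.le)
      _ = (k * τ) * b := by ring
      _ ≤ T * b := mul_le_mul_of_nonneg_right (hkT k hk) hb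
  have hcast : ∀ m : ℕ, ((m : ℝ) + 1) = ((m + 1 : ℕ) : ℝ) := fun m => by push_cast; ring
  have hψK0 : sobNorm s (ψK t₀) ≤ |C₀| := by
    have := (hR 0 (Nat.zero_le n)).1
    simpa using this
  have hI : ∀ k, k ≤ n → isTrig d K (psiIhat d K τ t₀ ψK uK k) ∧
      sobNorm s (psiIhat d K τ t₀ ψK uK k) ≤ B := by
    intro k hk
    obtain ⟨h1, h2⟩ := hsum k (fun m => phiK d K ψK uK (t₀ + ((m : ℝ) + 1) * τ)) |C₀| hk
      (abs_nonneg _) (fun m => tφK _) (fun m hm => by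
        simp only [hcast m]
        exact (hR (m + 1) (by lia)).2.2.2)
    refine ⟨(htK t₀).1.add h1, (sob_add_le (htK t₀).1 h1 s).trans ?_⟩
    have := abs_nonneg (2 * C₀ * M)
    have := mul_nonneg hT.le this
    linarith
  have hψb : ∀ k, k ≤ n → sobNorm s (ψn k) ≤ B := by
    intro k hk
    obtain ⟨h1, h2⟩ := hsum k (fun m => phin τ ψn (m + 1)) |2 * C₀ * M| hk
      (abs_nonneg _) (fun m => tφn _) (fun m hm => (hA (m + 1) (by lia) (by lia)).1)
    rw [psi_tele hτ ψn k, hψ0]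
    refine (sob_add_le (htK t₀).1 h1 s).trans ?_
    have := abs_nonneg (2 * C₀ * M)
    have := mul_nonneg hT.le (abs_nonneg C₀)
    linarith
  have hdiff : ∀ k, k ≤ n → sobNorm s (psiIhat d K τ t₀ ψK uK k - ψn k) ≤ T * e := by
    intro k hk
    obtain ⟨h1, h2⟩ := hsum k (fun m => phiK d K ψK uK (t₀ + ((m : ℝ) + 1) * τ)
      - phin τ ψn (m + 1)) e hk he0 (fun m => (tφK _).sub (tφn _)) (fun m hm => by
        simp only [hcast m]
        exact (hE (m + 1) (by lia) (by lia)).1)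
    have e1 : psiIhat d K τ t₀ ψK uK k - ψn k = (τ : ℂ) • ∑ m ∈ Finset.range k,
        (phiK d K ψK uK (t₀ + ((m : ℝ) + 1) * τ) - phin τ ψn (m + 1)) := by
      rw [psi_tele hτ ψn k, hψ0, psiIhat, Finset.sum_sub_distrib, smul_sub]
      abel
    rw [e1]; exact h2
  have hb1 : |C₀| ≤ B := by
    have := abs_nonneg (2 * C₀ * M)
    have : 0 ≤ T * (|C₀| + |2 * C₀ * M|) := by positivity
    linarith
  have hb2 : |2 * C₀ * M| ≤ B := by
    have := abs_nonneg C₀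
    have : 0 ≤ T * (|C₀| + |2 * C₀ * M|) := by positivity
    linarith
  -- the identity `ψ_{P,n} = ψ_n`
  obtain ⟨k, rfl⟩ : ∃ k, n = k + 1 := ⟨n - 1, by lia⟩
  have hid : psiPNew d K τ (phin τ ψn (k + 1)) (ψn (k + 1))
      (vNew d K τ (un (k + 1)) (udn (k + 1)) (ψn k)) = ψn (k + 1) := by
    refine psiP_eq hc hτ hcfl (isTrig.vNew (htn (k + 1)).2.1 (htn (k + 1)).2.2) (htn k).1 ?_
    rw [vNew_eq_vOrig hLT]
    exact (hLT k).1
  have hhat : psiPhat d K τ t₀ ψK uK udK (k + 1)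
      = psiPNew d K τ (phiK d K ψK uK (t₀ + ((k + 1 : ℕ) : ℝ) * τ)) (psiIhat d K τ t₀ ψK uK (k + 1))
        (vNew d K τ (uK (t₀ + ((k + 1 : ℕ) : ℝ) * τ)) (udK (t₀ + ((k + 1 : ℕ) : ℝ) * τ))
          (psiIhat d K τ t₀ ψK uK k)) := by
    rw [psiPhat, if_neg (Nat.succ_ne_zero k), vhat, Nat.add_sub_cancel]
  set t := t₀ + ((k + 1 : ℕ) : ℝ) * τ with ht
  obtain ⟨r1, r2, r3, r4⟩ := hR (k + 1) le_rfl
  obtain ⟨s1, s2, s3⟩ := hA (k + 1) (by lia) le_rfl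
  obtain ⟨d1, d2, d3⟩ := hE (k + 1) (by lia) le_rfl
  rw [← ht] at r1 r2 r3 r4 d1 d2 d3
  have hk1 : k ≤ k + 1 := Nat.le_succ k
  have hq := hCq K τ hτ hτT hcfl (phiK d K ψK uK t) (psiIhat d K τ t₀ ψK uK (k + 1)) (uK t) (udK t)
    (psiIhat d K τ t₀ ψK uK k) (phin τ ψn (k + 1)) (ψn (k + 1)) (un (k + 1)) (udn (k + 1)) (ψn k)
    (tφK t) (hI _ le_rfl).1 (htK t).2.1 (htK t).2.2 (hI k hk1).1
    (tφn _) (htn _).1 (htn _).2.1 (htn _).2.2 (htn k).1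
    (r4.trans hb1) (hI _ le_rfl).2 (r2.trans hb1) (r3.trans hb1) (hI k hk1).2
    (s1.trans hb2) (hψb _ le_rfl) (s2.trans hb2) (s3.trans hb2) (hψb k hk1)
  rw [hid, ← hhat] at hq
  have f1 := hdiff (k + 1) le_rfl
  have f2 := hdiff k hk1
  have hq2 : sobNorm (s + 2) (interp d K (absSq (psiPhat d K τ t₀ ψK uK udK (k + 1)))
      - interp d K (absSq (ψn (k + 1)))) ≤ Cq * ((3 + 2 * T) * e) :=
    hq.trans (mul_le_mul_of_nonneg_left (by linarith) hCq0)
  rw [hLT2, hLT3, uhatSucc, ← ht, (uStep_sub τ _ _ _ _ _ _).1, (uStep_sub τ _ _ _ _ _ _).2]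
  refine (wave_le hτ s ((htK t).2.1.sub (htn _).2.1) ((htK t).2.2.sub (htn _).2.2)
    ((isTrig_interp d K _).sub (isTrig_interp d K _))).trans ?_
  have g1 := mul_le_mul_of_nonneg_left d3 hτ.le
  have g2 := mul_le_mul_of_nonneg_left hq2 (show (0 : ℝ) ≤ 2 * τ by positivity)
  have g3 : τ * e + 2 * τ * (Cq * ((3 + 2 * T) * e)) = (1 + 2 * (Cq * (3 + 2 * T))) * τ * e := by
    ring
  linarith



end Zak
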